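/- For every ε > 0 there exists C > 0 such that the following holds: if t = t(n) and b = b(n) satisfy t ≥ C·n·log n and b ≥ (1+ε)·n, then there exists a (t,b)-strategy B of Builder such that the probability that the purchased graph B_t contains a Hamilton cycle tends to 1 as n → ∞. -/

import Mathlib

open Filter

attribute [local instance] Classical.propDecidable

/-- The edges of the complete graph on `Fin n`: non-diagonal unordered pairs. -/
abbrev CEdge (n : ℕ) : Type := {e : Sym2 (Fin n) // ¬ e.IsDiag}

/-- The sample space: a uniformly random ordering of the edges of `K_n`,
encoded as a bijection from positions to edges. -/
abbrev EdgeOrdering (n : ℕ) : Type := Fin (Fintype.card (CEdge n)) ≃ CEdge n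

/-- The uniform probability of an event on a finite sample space. -/
noncomputable def uprob {α : Type} [Fintype α] (P : α → Prop) : ℝ :=
  ((Finset.univ.filter P).card : ℝ) / (Fintype.card α : ℝ)

/-- A (deterministic) strategy of Builder: given the current time `s`, the graph `B_{s-1}`
of previously purchased edges, and the observed edge `e_s`, decide whether to purchase it. -/
def Strategy (n : ℕ) : Type := ℕ → Finset (CEdge n) → CEdge n → Bool

/-- Builder's purchased graph `B_s` at time `s`, playing strategy `S` with budget `b`
on the ordering `ω`.  An edge is purchased iff the strategy accepts it and the budget permits. -/
noncomputable def build (n b : ℕ) (S : Strategy n) (ω : EdgeOrdering n) : ℕ → Finset (CEdge n)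
  | 0 => ∅
  | s + 1 =>
    let P := build n b S ω s
    if h : s < Fintype.card (CEdge n) then
      if S s P (ω ⟨s, h⟩) = true ∧ P.card < b then insert (ω ⟨s, h⟩) P else P
    else P

/-- The degree of the vertex `v` in the graph given by the edge set `P`. -/
noncomputable def edegree (n : ℕ) (P : Finset (CEdge n)) (v : Fin n) : ℕ :=
  (P.filter (fun e => v ∈ (e : Sym2 (Fin n)))).card


/-- The simple graph on `Fin n` determined by a finite set of edges. -/
noncomputable def toGraph (n : ℕ) (P : Finset (CEdge n)) : SimpleGraph (Fin n) :=
  SimpleGraph.fromEdgeSet (↑(P.image Subtype.val))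

section ListPaths

/-- `x` is immediately followed by `y` in `l`. -/
def Follows {V : Type*} (l : List V) (x y : V) : Prop := [x, y] <:+: l

/-- `x` and `y` are consecutive in `l`, in one of the two orders. -/
def Consec {V : Type*} (l : List V) (x y : V) : Prop := Follows l x y ∨ Follows l y x

theorem Consec.symm {V : Type*} {l : List V} {x y : V} (h : Consec l x y) : Consec l y x :=
  Or.symm h

theorem follows_append {V : Type*} {X Y : List V} {a b : V} :
    Follows (X ++ Y) a b ↔
      Follows X a b ∨ Follows Y a b ∨ (X.getLast? = some a ∧ Y.head? = some b) := by
  unfold Follows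
  constructor
  · rintro ⟨S, T, h⟩
    rw [List.append_assoc, List.append_eq_append_iff] at h
    rcases h with ⟨Z, h1, h2⟩ | ⟨Z, h1, h2⟩
    · match Z, h1, h2 with
      | [], h1, h2 => exact Or.inr (Or.inl ⟨[], T, by simpa using h2⟩)
      | [z], h1, h2 =>
        simp only [List.cons_append, List.nil_append, List.cons.injEq] at h2
        refine Or.inr (Or.inr ⟨?_, ?_⟩)
        · rw [h1, ← h2.1]; simp
        · rw [← h2.2]; simp
      | z :: w :: Z, h1, h2 =>
        simp only [List.cons_append, List.nil_append, List.cons.injEq] at h2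
        exact Or.inl ⟨S, Z, by rw [h1, h2.1, h2.2.1]; simp⟩
    · exact Or.inr (Or.inl ⟨Z, T, by rw [h2]; simp⟩)
  · rintro (h | h | ⟨h1, h2⟩)
    · exact h.trans List.infix_append_left
    · exact h.trans List.infix_append_right
    · obtain ⟨X', rfl⟩ := List.getLast?_eq_some_iff.1 h1
      obtain ⟨Y', rfl⟩ := List.head?_eq_some_iff.1 h2
      exact ⟨X', Y', by simp⟩

theorem follows_reverse {V : Type*} {l : List V} {a b : V} :
    Follows l.reverse a b ↔ Follows l b a := by
  unfold Follows
  rw [← List.reverse_infix]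
  simp

theorem consec_reverse {V : Type*} {l : List V} {a b : V} :
    Consec l.reverse a b ↔ Consec l a b := by
  unfold Consec
  rw [follows_reverse, follows_reverse, or_comm]

theorem Follows.eq_right {V : Type*} {l : List V} (hl : l.Nodup) {x y z : V}
    (h1 : Follows l x y) (h2 : Follows l x z) : y = z := by
  induction l with
  | nil => simp [Follows] at h1
  | cons a l ih =>
    have hn := List.nodup_cons.1 hl
    have key : ∀ w, Follows (a :: l) x w → (x = a ∧ l.head? = some w) ∨ Follows l x w := by
      intro w hw
      rcases (follows_append (X := [a])).1 hw with h | h | h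
      · have := h.length_le; simp at this
      · exact Or.inr h
      · exact Or.inl ⟨by simpa using h.1.symm, h.2⟩
    have hm : ∀ w, Follows l x w → x ∈ l := fun w hw => hw.subset (by simp)
    rcases key y h1 with h | h <;> rcases key z h2 with h' | h'
    · exact Option.some_injective _ (h.2.symm.trans h'.2)
    · exact absurd (h.1 ▸ hm _ h') hn.1
    · exact absurd (h'.1 ▸ hm _ h) hn.1
    · exact ih hn.2 h h'

theorem Follows.eq_left {V : Type*} {l : List V} (hl : l.Nodup) {x y z : V}
    (h1 : Follows l y x) (h2 : Follows l z x) : y = z :=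
  Follows.eq_right (List.nodup_reverse.2 hl) (follows_reverse.2 h1) (follows_reverse.2 h2)

theorem not_follows_head {V : Type*} {l : List V} (hl : l.Nodup) {x u : V}
    (hu : l.head? = some u) : ¬ Follows l x u := by
  obtain ⟨Y, rfl⟩ := List.head?_eq_some_iff.1 hu
  intro h
  rcases (follows_append (X := [u])).1 h with h | h | h
  · have := h.length_le; simp at this
  · exact (List.nodup_cons.1 hl).1 (h.subset (by simp))
  · exact (List.nodup_cons.1 hl).1 (List.mem_of_head? h.2)

theorem not_follows_last {V : Type*} {l : List V} (hl : l.Nodup) {x u : V}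
    (hu : l.getLast? = some u) : ¬ Follows l u x := by
  intro h
  exact not_follows_head (List.nodup_reverse.2 hl) (by simpa using hu) (follows_reverse.2 h)

/-- The number of consecutive pairs of a list that are not edges of `G`. -/
noncomputable def breaks {V : Type*} (G : SimpleGraph V) : List V → ℕ
  | x :: y :: l => (if G.Adj x y then 0 else 1) + breaks G (y :: l)
  | _ => 0

theorem breaks_append_cons {V : Type*} (G : SimpleGraph V) (X Y : List V) (x : V) :
    breaks G (X ++ x :: Y) = breaks G (X ++ [x]) + breaks G (x :: Y) := by
  induction X with
  | nil => simp [breaks]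
  | cons a X ih =>
    cases X with
    | nil => simp [breaks]
    | cons b X =>
      simp only [List.cons_append] at ih ⊢
      rw [breaks, breaks, ih]
      ring

theorem breaks_append {V : Type*} (G : SimpleGraph V) (X Y : List V) (x y : V) :
    breaks G ((X ++ [x]) ++ y :: Y) =
      breaks G (X ++ [x]) + (if G.Adj x y then 0 else 1) + breaks G (y :: Y) := by
  rw [List.append_assoc, List.singleton_append, breaks_append_cons, breaks]
  ring

theorem breaks_reverse {V : Type*} (G : SimpleGraph V) (l : List V) :
    breaks G l.reverse = breaks G l := by
  induction l with
  | nil => rfl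
  | cons a l ih =>
    cases l with
    | nil => rfl
    | cons b l =>
      rw [breaks, ← ih]
      simp only [List.reverse_cons, List.append_assoc, List.cons_append, List.nil_append]
      rw [breaks_append_cons]
      simp only [breaks, G.adj_comm b a]
      ring

theorem breaks_le_cons {V : Type*} (G : SimpleGraph V) (x : V) (l : List V) :
    breaks G l ≤ breaks G (x :: l) := by
  cases l with
  | nil => simp [breaks]
  | cons b l => rw [breaks]; omega

theorem breaks_mono {V : Type*} {G G' : SimpleGraph V} (h : G ≤ G') (l : List V) :
    breaks G' l ≤ breaks G l := by
  induction l with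
  | nil => simp [breaks]
  | cons a l ih =>
    cases l with
    | nil => simp [breaks]
    | cons b l =>
      rw [breaks, breaks]
      have : (if G'.Adj a b then 0 else 1) ≤ (if G.Adj a b then 0 else 1) := by
        by_cases hG : G.Adj a b
        · simp [hG, h hG]
        · split_ifs <;> simp
      omega

theorem breaks_eq_zero {V : Type*} {G : SimpleGraph V} {l : List V} (h : breaks G l = 0) :
    l.IsChain G.Adj := by
  induction l with
  | nil => exact List.IsChain.nil
  | cons a l ih =>
    cases l with
    | nil => exact List.IsChain.singleton a
    | cons b l =>
      rw [breaks] at h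
      refine List.isChain_cons_cons.2 ⟨?_, ih (by omega)⟩
      by_contra hG
      simp [hG] at h

/-- The last vertex of `l` is adjacent to the first one. -/
def Closes {V : Type*} (G : SimpleGraph V) (l : List V) : Prop :=
  ∃ u v, l.head? = some u ∧ l.getLast? = some v ∧ G.Adj v u

/-- The number of cyclically consecutive pairs of a list that are not edges of `G`. -/
noncomputable def cyclicBreaks {V : Type*} (G : SimpleGraph V) (l : List V) : ℕ :=
  breaks G l + if Closes G l then 0 else 1

/-- All pairs in `F` are consecutive in `l`. -/
def Carries {V : Type*} (F : Set (Sym2 V)) (l : List V) : Prop :=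
  ∀ a b, s(a, b) ∈ F → Consec l a b

/-- `l` lists every element of `V` exactly once. -/
def Enumerates {V : Type*} (l : List V) : Prop := l.Nodup ∧ ∀ v, v ∈ l

/-- The least number of breaks in a cyclic ordering of the vertices that carries `F`. -/
noncomputable def completion {V : Type*} (G : SimpleGraph V) (F : Set (Sym2 V)) : ℕ :=
  sInf {k | ∃ l : List V, Enumerates l ∧ Carries F l ∧ cyclicBreaks G l = k}

theorem completion_le {V : Type*} {G : SimpleGraph V} {F : Set (Sym2 V)} {l : List V}
    (h1 : Enumerates l) (h2 : Carries F l) : completion G F ≤ cyclicBreaks G l :=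
  Nat.sInf_le ⟨l, h1, h2, rfl⟩

theorem exists_completion {V : Type*} (G : SimpleGraph V) {F : Set (Sym2 V)}
    (h : ∃ l : List V, Enumerates l ∧ Carries F l) :
    ∃ l : List V, Enumerates l ∧ Carries F l ∧ cyclicBreaks G l = completion G F := by
  obtain ⟨l, h1, h2⟩ := h
  exact Nat.sInf_mem (s := {k | ∃ l : List V, Enumerates l ∧ Carries F l ∧ cyclicBreaks G l = k})
    ⟨_, l, h1, h2, rfl⟩

theorem Enumerates.perm {V : Type*} {l l' : List V} (h : Enumerates l) (hp : l'.Perm l) :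
    Enumerates l' :=
  ⟨hp.nodup_iff.2 h.1, fun v => hp.mem_iff.2 (h.2 v)⟩

theorem Enumerates.reverse {V : Type*} {l : List V} (h : Enumerates l) : Enumerates l.reverse :=
  h.perm (List.reverse_perm l)

theorem Carries.reverse {V : Type*} {F : Set (Sym2 V)} {l : List V} (h : Carries F l) :
    Carries F l.reverse :=
  fun a b hab => consec_reverse.2 (h a b hab)

/-- An optimal cyclic ordering with a break can be cut at a break. -/
theorem exists_path_of_completion_pos {V : Type*} {G : SimpleGraph V} {F : Set (Sym2 V)}
    (hFG : ∀ a b, s(a, b) ∈ F → G.Adj a b)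
    (hne : ∃ l : List V, Enumerates l ∧ Carries F l) (hpos : 0 < completion G F) :
    ∃ l : List V, Enumerates l ∧ Carries F l ∧ breaks G l + 1 = completion G F := by
  obtain ⟨l, h1, h2, h3⟩ := exists_completion G hne
  by_cases hc : Closes G l
  · have hb : breaks G l ≠ 0 := by
      intro h0
      simp [cyclicBreaks, hc, h0] at h3
      omega
    have hsplit : ∀ l : List V, breaks G l ≠ 0 →
        ∃ X x y Y, l = (X ++ [x]) ++ y :: Y ∧ ¬ G.Adj x y := by
      intro l
      induction l with
      | nil => simp [breaks]
      | cons a l ih =>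
        intro hl
        cases l with
        | nil => simp [breaks] at hl
        | cons b l =>
          by_cases hab : G.Adj a b
          · rw [breaks, if_pos hab, zero_add] at hl
            obtain ⟨X, x, y, Y, h, hxy⟩ := ih hl
            exact ⟨a :: X, x, y, Y, by rw [h]; simp, hxy⟩
          · exact ⟨[], a, b, l, by simp, hab⟩
    obtain ⟨X, x, y, Y, hl, hxy⟩ := hsplit l hb
    obtain ⟨u, v, hu, hv, hvu⟩ := hc
    have hrev : ∃ Z, y :: Y = Z ++ [v] := by
      rw [hl, List.getLast?_append_of_ne_nil _ (by simp)] at hv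
      exact List.getLast?_eq_some_iff.1 hv
    obtain ⟨Z, hZ⟩ := hrev
    have hfw : ∃ W, X ++ [x] = u :: W := by
      rw [hl, List.head?_append_of_ne_nil _ (by simp)] at hu
      exact List.head?_eq_some_iff.1 hu
    obtain ⟨W, hW⟩ := hfw
    refine ⟨(y :: Y) ++ (X ++ [x]), h1.perm (by rw [hl]; exact List.perm_append_comm), ?_, ?_⟩
    · intro a b hab
      have hk : ∀ a b, s(a, b) ∈ F → Follows l a b → Follows ((y :: Y) ++ (X ++ [x])) a b := by
        intro a b hab h
        rw [hl] at h
        rcases follows_append.1 h with h | h | h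
        · exact follows_append.2 (Or.inr (Or.inl h))
        · exact follows_append.2 (Or.inl h)
        · exfalso
          apply hxy
          have e1 : x = a := by simpa using h.1
          have e2 : y = b := by simpa using h.2
          rw [e1, e2]
          exact hFG a b hab
      rcases h2 a b hab with h | h
      · exact Or.inl (hk a b hab h)
      · exact Or.inr (hk b a (by rwa [Sym2.eq_swap]) h)
    · rw [← h3, cyclicBreaks, if_pos ⟨u, v, hu, hv, hvu⟩, hl, breaks_append, if_neg hxy, hZ, hW,
        breaks_append, if_pos hvu]
      ring
  · exact ⟨l, h1, h2, by rw [← h3, cyclicBreaks, if_neg hc]⟩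

end ListPaths

section Rotations

/-- `Rotates G W l l'`: the list `l'` arises from `l` by rotations with pivots in `W`. -/
inductive Rotates {V : Type*} (G : SimpleGraph V) (W : Finset V) (l : List V) : List V → Prop
  | refl : Rotates G W l l
  | step (X Y : List V) (x y v : V) (hr : Rotates G W l (X ++ x :: (y :: Y))) (hx : x ∈ W)
      (hv : (y :: Y).getLast? = some v) (hvx : G.Adj v x) :
      Rotates G W l (X ++ x :: (y :: Y).reverse)

/-- The last vertices of the lists that arise from `l` by rotations. -/
noncomputable def rotationEnds {V : Type*} [Fintype V] (G : SimpleGraph V) (W : Finset V)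
    (l : List V) : Finset V :=
  Finset.univ.filter fun v => ∃ l', Rotates G W l l' ∧ l'.getLast? = some v

theorem mem_rotationEnds {V : Type*} [Fintype V] {G : SimpleGraph V} {W : Finset V}
    {l : List V} {v : V} :
    v ∈ rotationEnds G W l ↔ ∃ l', Rotates G W l l' ∧ l'.getLast? = some v := by
  simp [rotationEnds]

theorem Rotates.perm {V : Type*} {G : SimpleGraph V} {W : Finset V} {l l' : List V}
    (h : Rotates G W l l') : l'.Perm l := by
  induction h with
  | refl => exact List.Perm.refl _
  | step X Y x y v hr hx hv hvx ih =>
    refine List.Perm.trans ?_ ih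
    exact List.Perm.append_left _ (List.Perm.cons _ (List.reverse_perm _))

theorem Rotates.head {V : Type*} {G : SimpleGraph V} {W : Finset V} {l l' : List V}
    (h : Rotates G W l l') : l'.head? = l.head? := by
  induction h with
  | refl => rfl
  | step X Y x y v hr hx hv hvx ih =>
    rw [← ih]
    cases X <;> simp

theorem Rotates.breaks_le {V : Type*} {G : SimpleGraph V} {W : Finset V} {l l' : List V}
    (h : Rotates G W l l') : breaks G l' ≤ breaks G l := by
  induction h with
  | refl => exact le_rfl
  | step X Y x y v hr hx hv hvx ih =>
    refine le_trans ?_ ih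
    rw [breaks_append_cons, breaks_append_cons G X (y :: Y)]
    have h1 : breaks G (x :: (y :: Y).reverse) ≤ breaks G (x :: y :: Y) := by
      obtain ⟨Z, hZ⟩ := List.getLast?_eq_some_iff.1 hv
      calc breaks G (x :: (y :: Y).reverse) = breaks G ((y :: Y).reverse) := by
            rw [hZ, List.reverse_append]
            simp [breaks, hvx.symm]
        _ = breaks G (y :: Y) := breaks_reverse _ _
        _ ≤ _ := breaks_le_cons _ _ _
    omega

theorem rotation_getLast {V : Type*} (X Y : List V) (x y : V) :
    (X ++ x :: (y :: Y).reverse).getLast? = some y := by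
  have e : X ++ x :: (y :: Y).reverse = (X ++ x :: Y.reverse) ++ [y] := by simp
  rw [e, List.getLast?_concat]

theorem rotation_follows {V : Type*} {X Y : List V} {x y a b : V}
    (h : Follows (X ++ x :: (y :: Y)) a b) :
    Consec (X ++ x :: (y :: Y).reverse) a b ∨ (a = x ∧ b = y) := by
  have e : ∀ Z : List V, X ++ x :: Z = (X ++ [x]) ++ Z := by simp
  rw [e] at h ⊢
  rcases follows_append.1 h with h | h | h
  · exact Or.inl (Or.inl (follows_append.2 (Or.inl h)))
  · exact Or.inl (Or.inr (follows_append.2 (Or.inr (Or.inl (follows_reverse.2 h)))))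
  · refine Or.inr ⟨?_, ?_⟩
    · simpa using h.1.symm
    · simpa using h.2.symm

theorem rotation_consec {V : Type*} {X Y : List V} {x y a b : V}
    (h : Consec (X ++ x :: (y :: Y)) a b) :
    Consec (X ++ x :: (y :: Y).reverse) a b ∨ s(a, b) = s(x, y) := by
  rcases h with h | h
  · rcases rotation_follows h with h | ⟨rfl, rfl⟩
    · exact Or.inl h
    · exact Or.inr rfl
  · rcases rotation_follows h with h | ⟨rfl, rfl⟩
    · exact Or.inl h.symm
    · exact Or.inr Sym2.eq_swap

theorem Rotates.carries {V : Type*} {G : SimpleGraph V} {W : Finset V} {l l' : List V}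
    (h : Rotates G W l l') {F : Set (Sym2 V)} (hFW : ∀ a b, s(a, b) ∈ F → a ∉ W)
    (hl : Carries F l) : Carries F l' := by
  induction h with
  | refl => exact hl
  | step X Y x y v hr hx hv hvx ih =>
    intro a b hab
    rcases rotation_consec (ih a b hab) with h | h
    · exact h
    · rw [h] at hab
      exact absurd hx (hFW _ _ hab)

theorem Rotates.consec {V : Type*} [Fintype V] {G : SimpleGraph V} {W : Finset V} {l l' : List V}
    (h : Rotates G W l l') {a b : V} (hab : Consec l a b) (ha : a ∉ rotationEnds G W l)
    (hb : b ∉ rotationEnds G W l) : Consec l' a b := by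
  induction h with
  | refl => exact hab
  | step X Y x y v hr hx hv hvx ih =>
    rcases rotation_consec ih with h | h
    · exact h
    · exfalso
      have hy : y ∈ rotationEnds G W l :=
        mem_rotationEnds.2 ⟨_, Rotates.step X Y x y v hr hx hv hvx, rotation_getLast X Y x y⟩
      rcases Sym2.eq_iff.1 h with ⟨_, rfl⟩ | ⟨rfl, _⟩
      · exact hb hy
      · exact ha hy

/-- Pósa's lemma: pivots adjacent to the set of ends lie in it or next to it. -/
theorem rotationEnds_neighbor {V : Type*} [Fintype V] {G : SimpleGraph V} {W : Finset V}
    {l : List V} (hl : Enumerates l) {v x : V} (hv : v ∈ rotationEnds G W l) (hx : x ∈ W)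
    (hvx : G.Adj v x) :
    x ∈ rotationEnds G W l ∨ ∃ y ∈ rotationEnds G W l, Consec l y x := by
  obtain ⟨l', hr, hlast⟩ := mem_rotationEnds.1 hv
  have hl' : Enumerates l' := hl.perm hr.perm
  by_contra hcon
  push Not at hcon
  obtain ⟨hxR, hcon⟩ := hcon
  obtain ⟨X, Z, hXZ⟩ := List.append_of_mem (hl'.2 x)
  have hvx' : v ≠ x := hvx.ne
  obtain ⟨y, Y, rfl⟩ : ∃ y Y, Z = y :: Y := by
    cases Z with
    | nil =>
      exfalso
      rw [hXZ] at hlast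
      exact hvx' (by simpa using hlast.symm)
    | cons y Y => exact ⟨y, Y, rfl⟩
  rw [hXZ] at hr hlast hl'
  have hvY : (y :: Y).getLast? = some v := by
    rw [List.getLast?_append_of_ne_nil _ (by simp), List.getLast?_cons_cons] at hlast
    exact hlast
  have hy : y ∈ rotationEnds G W l :=
    mem_rotationEnds.2 ⟨_, Rotates.step X Y x y v hr hx hvY hvx, rotation_getLast X Y x y⟩
  have hxy : Follows (X ++ x :: (y :: Y)) x y := ⟨X, Y, by simp⟩
  have hpred : ∀ z, Consec l z x → Follows (X ++ x :: (y :: Y)) z x := by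
    intro z hz
    have hzR : z ∉ rotationEnds G W l := fun h => hcon z h hz
    rcases hr.consec hz hzR hxR with h | h
    · exact h
    · exact absurd (Follows.eq_right hl'.1 h hxy ▸ hy) hzR
  obtain ⟨X₀, Z₀, h0⟩ := List.append_of_mem (hl.2 x)
  obtain ⟨q, Y₀, rfl⟩ : ∃ q Y₀, Z₀ = q :: Y₀ := by
    cases Z₀ with
    | nil =>
      exact absurd (mem_rotationEnds.2 ⟨l, Rotates.refl, by rw [h0]; simp⟩) hxR
    | cons q Y₀ => exact ⟨q, Y₀, rfl⟩
  have hq : Follows (X ++ x :: (y :: Y)) q x :=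
    hpred q (Or.inr ⟨X₀, Y₀, by rw [h0]; simp⟩)
  rcases List.eq_nil_or_concat X₀ with rfl | ⟨X₁, p, rfl⟩
  · exact not_follows_head hl'.1 (u := x) (by rw [hr.head, h0]; simp) hq
  · have hp : Follows (X ++ x :: (y :: Y)) p x :=
      hpred p (Or.inl ⟨X₁, q :: Y₀, by rw [h0]; simp⟩)
    have hpq : p = q := Follows.eq_left hl'.1 hp hq
    have hnd := hl.1
    rw [h0, hpq] at hnd
    simp [List.nodup_append] at hnd

theorem rotationEnds_card {V : Type*} [Fintype V] {G : SimpleGraph V} {W : Finset V}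
    {l : List V} (hl : Enumerates l) :
    (W.filter fun x => ∃ v ∈ rotationEnds G W l, G.Adj v x).card ≤
      3 * (rotationEnds G W l).card := by
  set R := rotationEnds G W l with hR
  let A1 := Finset.univ.filter fun x => ∃ y ∈ R, Follows l y x
  let A2 := Finset.univ.filter fun x => ∃ y ∈ R, Follows l x y
  have h1 : A1.card ≤ R.card := by
    have : ∀ x ∈ A1, ∃ y ∈ R, Follows l y x := fun x hx => (Finset.mem_filter.1 hx).2
    choose! f hf1 hf2 using this
    refine Finset.card_le_card_of_injOn f hf1 ?_
    intro a ha b hb hab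
    exact Follows.eq_right hl.1 (hf2 a ha) (hab ▸ hf2 b hb)
  have h2 : A2.card ≤ R.card := by
    have : ∀ x ∈ A2, ∃ y ∈ R, Follows l x y := fun x hx => (Finset.mem_filter.1 hx).2
    choose! f hf1 hf2 using this
    refine Finset.card_le_card_of_injOn f hf1 ?_
    intro a ha b hb hab
    exact Follows.eq_left hl.1 (hf2 a ha) (hab ▸ hf2 b hb)
  have hsub : (W.filter fun x => ∃ v ∈ R, G.Adj v x) ⊆ R ∪ (A1 ∪ A2) := by
    intro x hx
    obtain ⟨hxW, v, hv, hvx⟩ := Finset.mem_filter.1 hx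
    rcases rotationEnds_neighbor hl hv hxW hvx with h | ⟨y, hy, h | h⟩
    · exact Finset.mem_union_left _ h
    · exact Finset.mem_union_right _ (Finset.mem_union_left _
        (Finset.mem_filter.2 ⟨Finset.mem_univ _, y, hy, h⟩))
    · exact Finset.mem_union_right _ (Finset.mem_union_right _
        (Finset.mem_filter.2 ⟨Finset.mem_univ _, y, hy, h⟩))
  have h3 := Finset.card_le_card hsub
  have h4 := Finset.card_union_le R (A1 ∪ A2)
  have h5 := Finset.card_union_le A1 A2
  omega

/-- A vertex with two neighbours in `F` is not the last vertex of a list carrying `F`. -/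
theorem mem_of_getLast {V : Type*} {A : Finset V} {F : Set (Sym2 V)}
    (hA : ∀ v, v ∉ A → ∃ p q, p ≠ q ∧ s(p, v) ∈ F ∧ s(q, v) ∈ F) {l : List V} (hl : l.Nodup)
    (hF : Carries F l) {v : V} (hv : l.getLast? = some v) : v ∈ A := by
  by_contra h
  obtain ⟨p, q, hpq, hp, hq⟩ := hA v h
  have : ∀ z, s(z, v) ∈ F → Follows l z v := fun z hz =>
    (hF z v hz).resolve_right (not_follows_last hl hv)
  exact hpq (Follows.eq_left hl (this p hp) (this q hq))

theorem rotationEnds_large {V : Type*} [Fintype V] {G : SimpleGraph V} {W A : Finset V}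
    {F : Set (Sym2 V)} (hFW : ∀ a b, s(a, b) ∈ F → a ∉ W)
    (hA : ∀ v, v ∉ A → ∃ p q, p ≠ q ∧ s(p, v) ∈ F ∧ s(q, v) ∈ F) {r : ℕ}
    (hexp : ∀ S ⊆ A, S.Nonempty → S.card ≤ r →
      3 * S.card < (W.filter fun x => ∃ v ∈ S, G.Adj v x).card)
    {l : List V} (hl : Enumerates l) (hF : Carries F l) {u : V} (hu : l.head? = some u) :
    r < (rotationEnds G W l).card := by
  by_contra hcon
  have h1 := rotationEnds_card (G := G) (W := W) hl
  have h2 := hexp (rotationEnds G W l) ?_ ?_ (by omega)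
  · omega
  · intro v hv
    obtain ⟨l', hr, hv⟩ := mem_rotationEnds.1 hv
    exact mem_of_getLast hA (hl.perm hr.perm).1 (hr.carries hFW hF) hv
  · have hne : l ≠ [] := by rintro rfl; simp at hu
    exact ⟨l.getLast hne, mem_rotationEnds.2
      ⟨l, Rotates.refl, List.getLast?_eq_getLast_of_ne_nil hne⟩⟩

/-- In an expanding graph there are many pairs whose addition lowers the completion number. -/
theorem exists_boosters {V : Type*} [Fintype V] {G : SimpleGraph V} {W A : Finset V}
    {F : Set (Sym2 V)} (hFG : ∀ a b, s(a, b) ∈ F → G.Adj a b)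
    (hFW : ∀ a b, s(a, b) ∈ F → a ∉ W)
    (hA : ∀ v, v ∉ A → ∃ p q, p ≠ q ∧ s(p, v) ∈ F ∧ s(q, v) ∈ F) {r : ℕ}
    (hexp : ∀ S ⊆ A, S.Nonempty → S.card ≤ r →
      3 * S.card < (W.filter fun x => ∃ v ∈ S, G.Adj v x).card)
    (hne : ∃ l : List V, Enumerates l ∧ Carries F l) (hpos : 0 < completion G F)
    (hV : 2 ≤ Fintype.card V) :
    ∃ T : Finset V, r < T.card ∧ ∀ u ∈ T, ∃ R : Finset V, r < R.card ∧ ∀ w ∈ R,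
      u ≠ w ∧ u ∈ A ∧ w ∈ A ∧
        ∀ G' : SimpleGraph V, G ≤ G' → G'.Adj u w → completion G' F < completion G F := by
  obtain ⟨l, hl, hF, hb⟩ := exists_path_of_completion_pos hFG hne hpos
  have hlen : ∀ l : List V, Enumerates l → 2 ≤ l.length := by
    intro l hl
    have : Fintype.card V ≤ l.length := by
      rw [← Finset.card_univ, ← List.toFinset_card_of_nodup hl.1]
      exact Finset.card_le_card fun v _ => List.mem_toFinset.2 (hl.2 v)
    omega
  have hhead : ∀ l : List V, Enumerates l → ∃ u, l.head? = some u := by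
    intro l hl
    have := hlen l hl
    match l, this with
    | a :: l, _ => exact ⟨a, rfl⟩
  obtain ⟨u₀, hu₀⟩ := hhead l hl
  refine ⟨rotationEnds G W l, rotationEnds_large hFW hA hexp hl hF hu₀, ?_⟩
  intro u hu
  obtain ⟨l', hr, hlast⟩ := mem_rotationEnds.1 hu
  have hl' := (hl.perm hr.perm).reverse
  have hF' := (hr.carries hFW hF).reverse
  have hb' : breaks G l'.reverse ≤ breaks G l := by
    rw [breaks_reverse]; exact hr.breaks_le
  have hhead' : l'.reverse.head? = some u := by simpa using hlast
  refine ⟨rotationEnds G W l'.reverse, rotationEnds_large hFW hA hexp hl' hF' hhead', ?_⟩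
  intro w hw
  obtain ⟨lw, hr', hlast'⟩ := mem_rotationEnds.1 hw
  have hlw := hl'.perm hr'.perm
  have hFw := hr'.carries hFW hF'
  have hheadw : lw.head? = some u := hr'.head.trans hhead'
  refine ⟨?_, mem_of_getLast hA (hl.perm hr.perm).1 (hr.carries hFW hF) hlast,
    mem_of_getLast hA hlw.1 hFw hlast', ?_⟩
  · rintro rfl
    have h2 := hlen lw hlw
    obtain ⟨Y, rfl⟩ := List.head?_eq_some_iff.1 hheadw
    cases Y with
    | nil => simp at h2
    | cons y Y =>
      rw [List.getLast?_cons_cons] at hlast'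
      exact (List.nodup_cons.1 hlw.1).1 (List.mem_of_getLast? hlast')
  · intro G' hGG' hadj
    have h1 : completion G' F ≤ cyclicBreaks G' lw := completion_le hlw hFw
    have h2 : cyclicBreaks G' lw = breaks G' lw := by
      rw [cyclicBreaks, if_pos ⟨u, w, hheadw, hlast', hadj.symm⟩, add_zero]
    have h3 := breaks_mono hGG' lw
    have h4 := hr'.breaks_le
    omega

theorem isHamiltonian_of_completion_eq_zero {V : Type*} [Fintype V] [DecidableEq V]
    {G : SimpleGraph V} {F : Set (Sym2 V)}
    (hV : 3 ≤ Fintype.card V) (hne : ∃ l : List V, Enumerates l ∧ Carries F l)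
    (h0 : completion G F = 0) : G.IsHamiltonian := by
  obtain ⟨l, hl, -, hb⟩ := exists_completion G hne
  rw [h0, cyclicBreaks] at hb
  have hc : Closes G l := by
    by_contra hc
    simp [hc] at hb
  have hb0 : breaks G l = 0 := by omega
  have hchain := breaks_eq_zero hb0
  obtain ⟨u, v, hu, hv, hvu⟩ := hc
  have hne' : l ≠ [] := by rintro rfl; simp at hu
  have hlen : l.length = Fintype.card V := by
    rw [← List.toFinset_card_of_nodup hl.1, ← Finset.card_univ]
    congr 1
    ext v
    simp [hl.2 v]
  intro _
  have hu' : l.head hne' = u := by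
    rw [List.head?_eq_some_head hne'] at hu; exact Option.some_injective _ hu
  have hv' : l.getLast hne' = v := by
    rw [List.getLast?_eq_getLast_of_ne_nil hne'] at hv; exact Option.some_injective _ hv
  have hadj : G.Adj (l.getLast hne') (l.head hne') := by rw [hu', hv']; exact hvu
  let p := SimpleGraph.Walk.ofSupport l hne' hchain
  have hp : p.support = l := SimpleGraph.Walk.support_ofSupport hne' hchain
  have hpath : p.IsPath := by
    rw [SimpleGraph.Walk.isPath_def, hp]; exact hl.1
  have hplen : p.length = l.length - 1 := SimpleGraph.Walk.length_ofSupport hne' hchain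
  refine ⟨_, SimpleGraph.Walk.cons hadj p, ?_⟩
  rw [SimpleGraph.Walk.isHamiltonianCycle_iff_isCycle_and_length_eq]
  refine ⟨?_, ?_⟩
  · rw [SimpleGraph.Walk.cons_isCycle_iff]
    refine ⟨hpath, ?_⟩
    intro he
    have := hpath.length_eq_one_of_mem_edges (Sym2.eq_swap ▸ he)
    omega
  · rw [SimpleGraph.Walk.length_cons]
    omega

end Rotations

section Probability

/-- The average of a function on a finite sample space. -/
noncomputable def mean {α : Type} [Fintype α] (f : α → ℝ) : ℝ :=
  (∑ x, f x) / (Fintype.card α : ℝ)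

theorem mean_le_mean {α : Type} [Fintype α] {f g : α → ℝ} (h : ∀ x, f x ≤ g x) :
    mean f ≤ mean g :=
  div_le_div_of_nonneg_right (Finset.sum_le_sum fun x _ => h x) (Nat.cast_nonneg _)

theorem mean_le_of_le {α : Type} [Fintype α] {f : α → ℝ} {c : ℝ} (hc : 0 ≤ c)
    (h : ∀ x, f x ≤ c) : mean f ≤ c := by
  refine (mean_le_mean h).trans ?_
  unfold mean
  rw [Finset.sum_const, nsmul_eq_mul, Finset.card_univ]
  rcases eq_or_ne (Fintype.card α : ℝ) 0 with h0 | h0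
  · rw [h0]; simpa using hc
  · rw [mul_div_cancel_left₀ _ h0]

theorem uprob_le_mean {α : Type} [Fintype α] {P : α → Prop} {f : α → ℝ}
    (h0 : ∀ x, 0 ≤ f x) (h1 : ∀ x, P x → 1 ≤ f x) : uprob P ≤ mean f := by
  refine div_le_div_of_nonneg_right ?_ (Nat.cast_nonneg _)
  rw [Finset.card_filter]
  push_cast
  refine Finset.sum_le_sum fun x _ => ?_
  split_ifs with h
  · exact h1 x h
  · exact h0 x

theorem mean_div {α : Type} [Fintype α] (f : α → ℝ) (c : ℝ) :
    mean (fun x => f x / c) = mean f / c := by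
  unfold mean
  rw [← Finset.sum_div, div_right_comm]

/-- Markov's inequality. -/
theorem uprob_le_mean_div {α : Type} [Fintype α] {P : α → Prop} {f : α → ℝ} {c : ℝ} (hc : 0 < c)
    (h0 : ∀ x, 0 ≤ f x) (h1 : ∀ x, P x → c ≤ f x) : uprob P ≤ mean f / c := by
  rw [← mean_div]
  exact uprob_le_mean (fun x => div_nonneg (h0 x) hc.le) fun x hx => (one_le_div hc).2 (h1 x hx)

theorem uprob_mono {α : Type} [Fintype α] {P Q : α → Prop} (h : ∀ x, P x → Q x) :
    uprob P ≤ uprob Q := by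
  refine div_le_div_of_nonneg_right ?_ (Nat.cast_nonneg _)
  exact_mod_cast Finset.card_le_card fun x hx => by
    simp only [Finset.mem_filter, Finset.mem_univ, true_and] at hx ⊢
    exact h x hx

theorem uprob_or_le {α : Type} [Fintype α] (P Q : α → Prop) :
    uprob (fun x => P x ∨ Q x) ≤ uprob P + uprob Q := by
  unfold uprob
  rw [← add_div]
  refine div_le_div_of_nonneg_right ?_ (Nat.cast_nonneg _)
  have hsub : (Finset.univ.filter fun x => P x ∨ Q x) ⊆
      Finset.univ.filter P ∪ Finset.univ.filter Q := by
    intro x hx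
    simpa using hx
  have := (Finset.card_le_card hsub).trans (Finset.card_union_le _ _)
  rw [← Nat.cast_add, Nat.cast_le]
  refine le_trans (le_of_eq ?_) this
  congr

theorem uprob_exists_le {α ι : Type} [Fintype α] (I : Finset ι) (P : ι → α → Prop) :
    uprob (fun x => ∃ i ∈ I, P i x) ≤ ∑ i ∈ I, uprob (P i) := by
  unfold uprob
  rw [← Finset.sum_div]
  refine div_le_div_of_nonneg_right ?_ (Nat.cast_nonneg _)
  have : (Finset.univ.filter fun x => ∃ i ∈ I, P i x) ⊆
      I.biUnion fun i => Finset.univ.filter (P i) := by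
    intro x hx
    simpa using hx
  have h2 := (Finset.card_le_card this).trans Finset.card_biUnion_le
  rw [← Nat.cast_sum, Nat.cast_le]
  refine le_trans (le_of_eq ?_) h2
  congr

theorem uprob_le_one {α : Type} [Fintype α] (P : α → Prop) : uprob P ≤ 1 := by
  unfold uprob
  refine div_le_one_of_le₀ ?_ (Nat.cast_nonneg _)
  exact_mod_cast Finset.card_le_univ _

theorem one_le_uprob_add {α : Type} [Fintype α] [Nonempty α] {P Q : α → Prop}
    (h : ∀ x, P x ∨ Q x) : 1 ≤ uprob P + uprob Q := by
  refine le_trans ?_ (uprob_or_le P Q)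
  unfold uprob
  rw [one_le_div (by exact_mod_cast Fintype.card_pos), Nat.cast_le, ← Finset.card_univ]
  refine Finset.card_le_card fun x _ => ?_
  simpa using h x

/-- Exchange the entries at the positions `i` and `j` of an ordering. -/
def exchange {N : ℕ} {E : Type} (i j : Fin N) (ω : Fin N ≃ E) : Fin N ≃ E :=
  (Equiv.swap i j).trans ω

theorem sum_exchange {N : ℕ} {E : Type} [Fintype (Fin N ≃ E)] (i j : Fin N)
    (f : (Fin N ≃ E) → ℝ) : ∑ ω, f (exchange i j ω) = ∑ ω, f ω := by
  have hinv : Function.Involutive (exchange (E := E) i j) := by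
    intro ω
    ext k
    simp [exchange]
  exact Equiv.sum_comp hinv.toPerm f

/-- Multiplicative drift along a random ordering. -/
theorem sum_drift {N : ℕ} {E : Type} [Fintype (Fin N ≃ E)] (Φ : ℕ → (Fin N ≃ E) → ℝ)
    {r : ℝ} (hr : 0 ≤ r) {a b : ℕ} (hab : a ≤ b) (hb : b ≤ N)
    (h : ∀ s (hs : s < N), a ≤ s → s < b → ∀ ω,
      ∑ j ∈ Finset.univ.filter (fun j : Fin N => s ≤ j.val), Φ (s + 1) (exchange ⟨s, hs⟩ j ω) ≤
        r * (N - s) * Φ s ω) :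
    ∑ ω, Φ b ω ≤ r ^ (b - a) * ∑ ω, Φ a ω := by
  induction b, hab using Nat.le_induction with
  | base => simp
  | succ s has ih =>
    have hs : s < N := hb
    have ih' := ih (by omega) (fun s' hs' h1 h2 => h s' hs' h1 (by omega))
    have hpos : (0 : ℝ) < N - s := by
      have : (s : ℝ) < N := by exact_mod_cast hs
      linarith
    have hcard : ((Finset.univ.filter (fun j : Fin N => s ≤ j.val)).card : ℝ) = N - s := by
      have h1 : (Finset.univ.filter (fun j : Fin N => s ≤ j.val)) = Finset.Ici ⟨s, hs⟩ := by
        ext j; simp [Fin.le_def]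
      rw [h1, Fin.card_Ici]
      push_cast [hs.le]
      ring
    have key : (N - s : ℝ) * ∑ ω, Φ (s + 1) ω ≤ (N - s : ℝ) * (r * ∑ ω, Φ s ω) := by
      calc (N - s : ℝ) * ∑ ω, Φ (s + 1) ω
          = ∑ j ∈ Finset.univ.filter (fun j : Fin N => s ≤ j.val),
              ∑ ω, Φ (s + 1) (exchange ⟨s, hs⟩ j ω) := by
            simp_rw [sum_exchange]
            rw [Finset.sum_const, nsmul_eq_mul, hcard]
        _ = ∑ ω, ∑ j ∈ Finset.univ.filter (fun j : Fin N => s ≤ j.val),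
              Φ (s + 1) (exchange ⟨s, hs⟩ j ω) := Finset.sum_comm
        _ ≤ ∑ ω, r * (N - s) * Φ s ω :=
            Finset.sum_le_sum fun ω _ => h s hs has (by omega) ω
        _ = _ := by rw [← Finset.mul_sum]; ring
    have := le_of_mul_le_mul_left key hpos
    calc ∑ ω, Φ (s + 1) ω ≤ r * ∑ ω, Φ s ω := this
      _ ≤ r * (r ^ (s - a) * ∑ ω, Φ a ω) := mul_le_mul_of_nonneg_left ih' hr
      _ = r ^ (s + 1 - a) * ∑ ω, Φ a ω := by
        rw [Nat.sub_add_comm has, pow_succ]; ring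

end Probability

section Purchases

/-- The graph after Builder has decided about `e` at time `s`, without a budget. -/
noncomputable def nextGraph {n : ℕ} (S : Strategy n) (s : ℕ) (P : Finset (CEdge n))
    (e : CEdge n) : Finset (CEdge n) :=
  if S s P e = true then insert e P else P

/-- Builder's graph at time `s` if the budget is unlimited. -/
noncomputable def process {n : ℕ} (S : Strategy n) (ω : EdgeOrdering n) : ℕ → Finset (CEdge n)
  | 0 => ∅
  | s + 1 =>
    if h : s < Fintype.card (CEdge n) then nextGraph S s (process S ω s) (ω ⟨s, h⟩)
    else process S ω s

/-- The edges observed before time `s`. -/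
noncomputable def seen {n : ℕ} (ω : EdgeOrdering n) (s : ℕ) : Finset (CEdge n) :=
  Finset.univ.filter fun e => (ω.symm e).val < s

theorem subset_nextGraph {n : ℕ} (S : Strategy n) (s : ℕ) (P : Finset (CEdge n)) (e : CEdge n) :
    P ⊆ nextGraph S s P e := by
  unfold nextGraph
  split_ifs
  · exact Finset.subset_insert _ _
  · exact Finset.Subset.refl _

theorem process_subset_succ {n : ℕ} (S : Strategy n) (ω : EdgeOrdering n) (s : ℕ) :
    process S ω s ⊆ process S ω (s + 1) := by
  rw [process]
  split_ifs with h
  · exact subset_nextGraph _ _ _ _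
  · exact Finset.Subset.refl _

theorem process_mono {n : ℕ} (S : Strategy n) (ω : EdgeOrdering n) :
    Monotone (process S ω) :=
  monotone_nat_of_le_succ fun s => process_subset_succ S ω s

/-- An invariant of the process between two times. -/
theorem process_invariant {n : ℕ} {S : Strategy n} {ω : EdgeOrdering n}
    {p : Finset (CEdge n) → Prop} {a b : ℕ} (hab : a ≤ b) (ha : p (process S ω a))
    (hstep : ∀ s, a ≤ s → s < b → ∀ P e, p P → S s P e = true → p (insert e P)) :
    p (process S ω b) := by
  induction b, hab using Nat.le_induction with
  | base => exact ha
  | succ s has ih =>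
    have h1 := ih fun s' h1 h2 => hstep s' h1 (by omega)
    rw [process]
    split_ifs with h
    · unfold nextGraph
      split_ifs with h2
      · exact hstep s has (by omega) _ _ h1 h2
      · exact h1
    · exact h1

theorem process_subset_seen {n : ℕ} (S : Strategy n) (ω : EdgeOrdering n) (s : ℕ) :
    process S ω s ⊆ seen ω s := by
  induction s with
  | zero => simp [process]
  | succ s ih =>
    have hm : seen ω s ⊆ seen ω (s + 1) := fun e he => by
      simp only [seen, Finset.mem_filter, Finset.mem_univ, true_and] at he ⊢
      omega
    rw [process]
    split_ifs with h
    · unfold nextGraph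
      split_ifs with h2
      · refine Finset.insert_subset ?_ (ih.trans hm)
        simp [seen]
      · exact ih.trans hm
    · exact ih.trans hm

/-- The budget is irrelevant as long as the unlimited process does not exceed it. -/
theorem build_eq_process {n b : ℕ} {S : Strategy n} {ω : EdgeOrdering n} {t : ℕ}
    (h : (process S ω t).card ≤ b) : build n b S ω t = process S ω t := by
  induction t with
  | zero => rfl
  | succ s ih =>
    have h1 := Finset.card_le_card (process_subset_succ S ω s)
    have h2 := ih (h1.trans h)
    rw [build, process]
    rw [process] at h
    simp only [h2]
    by_cases hs : s < Fintype.card (CEdge n)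
    · rw [dif_pos hs] at h ⊢
      rw [dif_pos hs]
      unfold nextGraph at h ⊢
      by_cases hS : S s (process S ω s) (ω ⟨s, hs⟩) = true
      · rw [if_pos hS] at h
        have hmem : ω ⟨s, hs⟩ ∉ process S ω s := by
          intro hmem
          have := process_subset_seen S ω s hmem
          simp [seen] at this
        rw [Finset.card_insert_of_notMem hmem] at h
        have hc : S s (process S ω s) (ω ⟨s, hs⟩) = true ∧ (process S ω s).card < b := ⟨hS, h⟩
        simp only [hc, and_self, if_true]
      · rw [if_neg hS, if_neg fun hc => hS hc.1]
    · rw [dif_neg hs, dif_neg hs]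

theorem process_congr {n : ℕ} (S : Strategy n) {ω ω' : EdgeOrdering n} {s : ℕ}
    (h : ∀ k : Fin _, k.val < s → ω k = ω' k) : process S ω s = process S ω' s := by
  induction s with
  | zero => rfl
  | succ s ih =>
    rw [process, process, ih fun k hk => h k (by omega)]
    split_ifs with hs
    · rw [h ⟨s, hs⟩ (by simp)]
    · rfl

theorem exchange_apply_of_lt {N : ℕ} {E : Type} {i j k : Fin N} (ω : Fin N ≃ E)
    (hij : i ≤ j) (hk : k < i) : exchange i j ω k = ω k := by
  unfold exchange
  rw [Equiv.trans_apply, Equiv.swap_apply_of_ne_of_ne hk.ne (hk.trans_le hij).ne]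

theorem process_exchange {n : ℕ} (S : Strategy n) (ω : EdgeOrdering n)
    {i j : Fin (Fintype.card (CEdge n))} (hij : i ≤ j) {s : ℕ} (hs : s ≤ i.val) :
    process S (exchange i j ω) s = process S ω s :=
  process_congr S fun k hk => exchange_apply_of_lt ω hij (Fin.lt_def.2 (by omega))

theorem process_exchange_succ {n : ℕ} (S : Strategy n) (ω : EdgeOrdering n)
    {i j : Fin (Fintype.card (CEdge n))} (hij : i ≤ j) :
    process S (exchange i j ω) (i.val + 1) = nextGraph S i.val (process S ω i.val) (ω j) := by
  rw [process, dif_pos i.2, process_exchange S ω hij le_rfl]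
  simp [exchange]

theorem seen_exchange_succ {n : ℕ} (ω : EdgeOrdering n)
    {i j : Fin (Fintype.card (CEdge n))} (hij : i ≤ j) :
    seen (exchange i j ω) (i.val + 1) = insert (ω j) (seen ω i.val) := by
  ext e
  obtain ⟨k, rfl⟩ := ω.surjective e
  simp only [seen, Finset.mem_filter, Finset.mem_univ, true_and, Finset.mem_insert,
    EmbeddingLike.apply_eq_iff_eq, Equiv.symm_apply_apply]
  have hk : (exchange i j ω).symm (ω k) = Equiv.swap i j k := by simp [exchange]
  rw [hk, Equiv.swap_apply_def]
  rw [Fin.le_def] at hij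
  split_ifs with h1 h2
  · subst h1
    constructor
    · intro h; left; exact Fin.ext (by omega)
    · rintro (h | h)
      · rw [← h]; omega
      · omega
  · simp [h2]
  · simp only [Fin.ext_iff] at h1 h2 ⊢
    omega

theorem sum_unseen {n : ℕ} (ω : EdgeOrdering n) (s : ℕ) (f : CEdge n → ℝ) :
    ∑ j ∈ Finset.univ.filter (fun j : Fin (Fintype.card (CEdge n)) => s ≤ j.val), f (ω j) =
      ∑ e ∈ (seen ω s)ᶜ, f e := by
  refine Finset.sum_bij (fun j _ => ω j) ?_ ?_ ?_ ?_
  · intro j hj; simpa [seen] using hj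
  · intro a _ b _ h; exact ω.injective h
  · intro e he
    exact ⟨ω.symm e, by simpa [seen] using he, by simp⟩
  · intros; rfl

theorem card_seen {n : ℕ} (ω : EdgeOrdering n) {s : ℕ} (hs : s ≤ Fintype.card (CEdge n)) :
    (seen ω s).card = s := by
  have h1 : (seen ω s).card =
      (Finset.univ.filter fun k : Fin (Fintype.card (CEdge n)) => k.val < s).card := by
    refine Finset.card_bij (fun e _ => ω.symm e) ?_ ?_ ?_
    · intro e he; simpa [seen] using he
    · intro a _ b _ h; exact ω.symm.injective h
    · intro k hk; exact ⟨ω k, by simpa [seen] using hk, by simp⟩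
  rw [h1, Fin.card_filter_val_lt]
  omega

theorem card_unseen {n : ℕ} (ω : EdgeOrdering n) {s : ℕ} (hs : s ≤ Fintype.card (CEdge n)) :
    (((seen ω s)ᶜ).card : ℝ) = Fintype.card (CEdge n) - s := by
  rw [Finset.card_compl, card_seen ω hs]
  push_cast [hs]
  ring

/-- Multiplicative drift for a potential that depends on the graph at the initial time, on the
observed edges, and on the current graph. -/
theorem mean_drift {n : ℕ} (S : Strategy n)
    (φ : Finset (CEdge n) → Finset (CEdge n) → Finset (CEdge n) → ℝ)
    {r : ℝ} (hr : 0 ≤ r) {a b : ℕ} (hab : a ≤ b) (hb : b ≤ Fintype.card (CEdge n))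
    (h : ∀ s, a ≤ s → s < b → ∀ ω : EdgeOrdering n,
      ∑ e ∈ (seen ω s)ᶜ,
        φ (process S ω a) (insert e (seen ω s)) (nextGraph S s (process S ω s) e) ≤
        r * (Fintype.card (CEdge n) - s) * φ (process S ω a) (seen ω s) (process S ω s)) :
    mean (fun ω => φ (process S ω a) (seen ω b) (process S ω b)) ≤
      r ^ (b - a) * mean (fun ω => φ (process S ω a) (seen ω a) (process S ω a)) := by
  unfold mean
  rw [← mul_div_assoc]
  refine div_le_div_of_nonneg_right ?_ (Nat.cast_nonneg _)
  refine sum_drift (fun s ω => φ (process S ω a) (seen ω s) (process S ω s)) hr hab hb ?_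
  intro s hs has hsb ω
  refine le_trans (le_of_eq ?_) (h s has hsb ω)
  rw [← sum_unseen]
  refine Finset.sum_congr rfl fun j hj => ?_
  have hj' : (⟨s, hs⟩ : Fin (Fintype.card (CEdge n))) ≤ j :=
    Fin.le_def.2 (by simpa using hj)
  have h1 := process_exchange_succ S ω hj'
  have h2 := seen_exchange_succ ω hj'
  have h3 := process_exchange S ω hj' (s := a) has
  simp only at h1 h2
  rw [h1, h2, h3]

end Purchases

section Progress

theorem card_cedge (n : ℕ) : Fintype.card (CEdge n) = n.choose 2 := by
  have := Sym2.card_subtype_not_diag (α := Fin n)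
  rw [Fintype.card_fin] at this
  rw [← this]

theorem card_cedge_eq (n : ℕ) : (Fintype.card (CEdge n) : ℝ) = n * (n - 1) / 2 := by
  rw [card_cedge, Nat.cast_choose_two]

theorem card_cedge_le (n : ℕ) : (Fintype.card (CEdge n) : ℝ) ≤ n ^ 2 / 2 := by
  rw [card_cedge_eq]
  have : (0 : ℝ) ≤ n := Nat.cast_nonneg _
  nlinarith

/-- A potential that never increases and decreases for many edges vanishes quickly. -/
theorem uprob_pos_le {n : ℕ} (S : Strategy n) (ψ : Finset (CEdge n) → Finset (CEdge n) → ℕ)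
    {a b g : ℕ} (hab : a ≤ b) (hb : b ≤ Fintype.card (CEdge n)) (hbg : 2 * b ≤ g)
    (hg : (g : ℝ) ≤ (n : ℝ) ^ 3) (hn : 0 < n)
    (hle : ∀ ω : EdgeOrdering n, ∀ s, a ≤ s → s ≤ b → ψ (process S ω a) (process S ω s) ≤ n)
    (hmono : ∀ ω : EdgeOrdering n, ∀ s, a ≤ s → s < b → ∀ e,
      ψ (process S ω a) (nextGraph S s (process S ω s) e) ≤ ψ (process S ω a) (process S ω s))
    (hdec : ∀ ω : EdgeOrdering n, ∀ s, a ≤ s → s < b →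
      0 < ψ (process S ω a) (process S ω s) → ∃ D : Finset (CEdge n), g ≤ D.card ∧ ∀ e ∈ D,
      ψ (process S ω a) (nextGraph S s (process S ω s) e) < ψ (process S ω a) (process S ω s)) :
    uprob (fun ω : EdgeOrdering n => 0 < ψ (process S ω a) (process S ω b)) ≤
      (1 - g / (n : ℝ) ^ 3) ^ (b - a) * n := by
  have hn0 : (0 : ℝ) < n := by exact_mod_cast hn
  have hr : 0 ≤ 1 - g / (n : ℝ) ^ 3 := by
    have := (div_le_one (pow_pos hn0 3)).2 hg
    linarith
  refine (uprob_le_mean (f := fun ω => (ψ (process S ω a) (process S ω b) : ℝ))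
    (fun ω => Nat.cast_nonneg _) (fun ω h => by exact_mod_cast h)).trans ?_
  refine (mean_drift S (fun A _ P => (ψ A P : ℝ)) hr hab hb ?_).trans ?_
  · intro s has hsb ω
    have hsN : s ≤ Fintype.card (CEdge n) := by omega
    have hcard := card_unseen ω hsN
    have hNn := card_cedge_le n
    have hNs : (0 : ℝ) ≤ Fintype.card (CEdge n) - s := by
      have : (s : ℝ) ≤ Fintype.card (CEdge n) := by exact_mod_cast hsN
      linarith
    set N : ℝ := (Fintype.card (CEdge n) : ℝ)
    set p := ψ (process S ω a) (process S ω s) with hp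
    have hpn : (p : ℝ) ≤ n := by exact_mod_cast hle ω s has hsb.le
    have hs0 : (0 : ℝ) ≤ s := Nat.cast_nonneg _
    rcases Nat.eq_zero_or_pos p with h0 | h0
    · have hz : ∀ e, ψ (process S ω a) (nextGraph S s (process S ω s) e) = 0 := by
        intro e
        have := hmono ω s has hsb e
        omega
      simp [hz, h0]
    · obtain ⟨D, hD, hDe⟩ := hdec ω s has hsb h0
      have hgood : (g : ℝ) / 2 ≤ ((D \ seen ω s).card : ℝ) := by
        have h1 := Finset.le_card_sdiff (seen ω s) D
        rw [card_seen ω hsN] at h1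
        have h2 : g ≤ 2 * (D \ seen ω s).card := by omega
        have h3 : (g : ℝ) ≤ 2 * ((D \ seen ω s).card : ℝ) := by exact_mod_cast h2
        linarith
      have hsum : ∑ e ∈ (seen ω s)ᶜ, (ψ (process S ω a) (nextGraph S s (process S ω s) e) : ℝ) ≤
          ∑ e ∈ (seen ω s)ᶜ, ((p : ℝ) - if e ∈ D \ seen ω s then 1 else 0) := by
        refine Finset.sum_le_sum fun e _ => ?_
        split_ifs with he
        · have h1 : ψ (process S ω a) (nextGraph S s (process S ω s) e) + 1 ≤ p :=
            hDe e (Finset.mem_sdiff.1 he).1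
          have h2 : (ψ (process S ω a) (nextGraph S s (process S ω s) e) : ℝ) + 1 ≤ p := by
            exact_mod_cast h1
          linarith
        · rw [sub_zero]
          exact_mod_cast hmono ω s has hsb e
      refine hsum.trans ?_
      rw [Finset.sum_sub_distrib, Finset.sum_const, nsmul_eq_mul, hcard, Finset.sum_boole]
      have hfil : ((seen ω s)ᶜ.filter fun e => e ∈ D \ seen ω s) = D \ seen ω s := by
        ext e
        simp only [Finset.mem_filter, Finset.mem_compl, Finset.mem_sdiff]
        tauto
      rw [hfil]
      have hkey : g / (n : ℝ) ^ 3 * ((N - s) * p) ≤ g / 2 := by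
        have h1 : (N - s) * p ≤ (n : ℝ) ^ 2 / 2 * n :=
          mul_le_mul (by linarith) hpn (Nat.cast_nonneg _) (by positivity)
        calc g / (n : ℝ) ^ 3 * ((N - s) * p) ≤ g / (n : ℝ) ^ 3 * ((n : ℝ) ^ 2 / 2 * n) :=
              mul_le_mul_of_nonneg_left h1 (by positivity)
          _ = g / 2 := by field_simp
      nlinarith
  · refine mul_le_mul_of_nonneg_left ?_ (pow_nonneg hr _)
    exact mean_le_of_le hn0.le fun ω => by exact_mod_cast hle ω a le_rfl hab

end Progress

section Edges

/-- The edge joining two distinct vertices. -/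
def edge {n : ℕ} (u v : Fin n) (h : u ≠ v) : CEdge n := ⟨s(u, v), by simpa using h⟩

/-- The set of pairs underlying a finite set of edges. -/
def pairs {n : ℕ} (P : Finset (CEdge n)) : Set (Sym2 (Fin n)) := {z | ∃ e ∈ P, e.val = z}

theorem toGraph_adj {n : ℕ} {P : Finset (CEdge n)} {u v : Fin n} :
    (toGraph n P).Adj u v ↔ s(u, v) ∈ pairs P := by
  unfold toGraph pairs
  rw [SimpleGraph.fromEdgeSet_adj]
  constructor
  · rintro ⟨h, -⟩
    simpa using h
  · rintro ⟨e, he, h⟩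
    have h2 := e.2
    rw [h] at h2
    refine ⟨?_, by simpa using h2⟩
    simp only [Finset.coe_image, Set.mem_image]
    exact ⟨e, he, h⟩

theorem toGraph_mono {n : ℕ} {P Q : Finset (CEdge n)} (h : P ⊆ Q) : toGraph n P ≤ toGraph n Q := by
  intro u v
  rw [toGraph_adj, toGraph_adj]
  rintro ⟨e, he, h1⟩
  exact ⟨e, h he, h1⟩

theorem edge_mem_iff {n : ℕ} {P : Finset (CEdge n)} {u v : Fin n} (h : u ≠ v) :
    edge u v h ∈ P ↔ s(u, v) ∈ pairs P := by
  constructor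
  · intro h1
    exact ⟨_, h1, rfl⟩
  · rintro ⟨e, he, h1⟩
    have : e = edge u v h := Subtype.ext h1
    rwa [← this]

/-- `e` has no endpoint in `W`. -/
def Avoids {n : ℕ} (W : Finset (Fin n)) (e : CEdge n) : Prop := ∀ v ∈ e.val, v ∉ W

theorem exists_eq_edge {n : ℕ} (e : CEdge n) : ∃ u v, ∃ h : u ≠ v, e = edge u v h := by
  obtain ⟨z, hz⟩ := e
  induction z with
  | _ u v => exact ⟨u, v, by simpa using hz, rfl⟩

end Edges

section LinearForests

/-- `F` is contained in a Hamilton path of the complete graph. -/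
def LinForest {V : Type*} (F : Set (Sym2 V)) : Prop := ∃ l : List V, Enumerates l ∧ Carries F l

theorem LinForest.mono {V : Type*} {F F' : Set (Sym2 V)} (h : F ⊆ F') (hF : LinForest F') :
    LinForest F := by
  obtain ⟨l, h1, h2⟩ := hF
  exact ⟨l, h1, fun a b hab => h2 a b (h hab)⟩

theorem carries_interchange {V : Type*} {F : Set (Sym2 V)} {X Y Z : List V} {a b c d : V}
    (h : Carries F (X ++ (Y ++ Z))) (ha : X.getLast? = some a) (hb : Y.head? = some b)
    (hc : Y.getLast? = some c) (hd : Z.head? = some d) (hab : s(a, b) ∉ F) (hcd : s(c, d) ∉ F) :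
    Carries (insert s(a, d) F) (Y ++ (X ++ Z)) := by
  have had : Follows (Y ++ (X ++ Z)) a d :=
    follows_append.2 (Or.inr (Or.inl (follows_append.2 (Or.inr (Or.inr ⟨ha, hd⟩)))))
  have hfol : ∀ u v, s(u, v) ∈ F → Follows (X ++ (Y ++ Z)) u v → Follows (Y ++ (X ++ Z)) u v := by
    intro u v huv hf
    rcases follows_append.1 hf with hf | hf | hf
    · exact follows_append.2 (Or.inr (Or.inl (follows_append.2 (Or.inl hf))))
    · rcases follows_append.1 hf with hf | hf | hf
      · exact follows_append.2 (Or.inl hf)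
      · exact follows_append.2 (Or.inr (Or.inl (follows_append.2 (Or.inr (Or.inl hf)))))
      · rw [hc, hd] at hf
        simp only [Option.some.injEq] at hf
        rw [← hf.1, ← hf.2] at huv
        exact absurd huv hcd
    · rw [ha, List.head?_append, hb] at hf
      simp only [Option.some_or, Option.some.injEq] at hf
      rw [← hf.1, ← hf.2] at huv
      exact absurd huv hab
  intro u v huv
  rcases huv with huv | huv
  · rcases Sym2.eq_iff.1 huv with ⟨rfl, rfl⟩ | ⟨rfl, rfl⟩
    · exact Or.inl had
    · exact Or.inr had
  · rcases h u v huv with hf | hf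
    · exact Or.inl (hfol u v huv hf)
    · exact Or.inr (hfol v u (by rwa [Sym2.eq_swap]) hf)

theorem Enumerates.length_eq {n : ℕ} {l : List (Fin n)} (h : Enumerates l) : l.length = n := by
  have h1 : l.toFinset = Finset.univ := by
    ext v
    simp [h.2 v]
  rw [← List.toFinset_card_of_nodup h.1, h1, Finset.card_univ, Fintype.card_fin]

/-- A linear forest with few edges, all avoiding a small set, has many extensions. -/
theorem exists_extensions {n m : ℕ} {P : Finset (CEdge n)} {W : Finset (Fin n)}
    (hW : W.card ≤ 3 * m) (hF : LinForest (pairs P)) (hP : P.card < n - 8 * m) :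
    ∃ D : Finset (CEdge n), m ^ 2 ≤ D.card ∧
      ∀ e ∈ D, e ∉ P ∧ Avoids W e ∧ LinForest (pairs (insert e P)) := by
  obtain ⟨l, hl, hc⟩ := hF
  have hlen := hl.length_eq
  have hn : 0 < n := by omega
  set x : ℕ → Fin n := fun i => l.getD i ⟨0, hn⟩ with hx
  have hxi : ∀ i, i < n → l[i]? = some (x i) := by
    intro i hi
    simp [hx, List.getElem?_eq_getElem (hlen.symm ▸ hi : i < l.length)]
  have hinj : ∀ i j, i < n → j < n → x i = x j → i = j := by
    intro i j hi hj hij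
    have h1 := hxi i hi
    have h2 := hxi j hj
    rw [← hij, ← h1] at h2
    exact ((List.getElem?_inj (by omega) hl.1).1 h2.symm)
  set J := (Finset.range (n - 1)).filter
    fun i => s(x i, x (i + 1)) ∉ pairs P ∧ x i ∉ W ∧ x (i + 1) ∉ W with hJ
  have hJcard : 2 * m ≤ J.card := by
    have hcov : Finset.range (n - 1) ⊆ J ∪
        (((Finset.range (n - 1)).filter fun i => s(x i, x (i + 1)) ∈ pairs P) ∪
          (((Finset.range (n - 1)).filter fun i => x i ∈ W) ∪
          ((Finset.range (n - 1)).filter fun i => x (i + 1) ∈ W))) := by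
      intro i hi
      simp only [hJ, Finset.mem_union, Finset.mem_filter, hi, true_and]
      tauto
    have h1 : ((Finset.range (n - 1)).filter fun i => s(x i, x (i + 1)) ∈ pairs P).card ≤
        P.card := by
      have : (P.image Subtype.val).card ≤ P.card := Finset.card_image_le
      refine le_trans (Finset.card_le_card_of_injOn (fun i => s(x i, x (i + 1))) ?_ ?_) this
      · intro i hi
        obtain ⟨e, he, h⟩ := (Finset.mem_filter.1 hi).2
        exact Finset.mem_coe.2 (Finset.mem_image.2 ⟨e, he, h⟩)
      · intro i hi j hj hij
        have hi' := Finset.mem_range.1 (Finset.mem_filter.1 hi).1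
        have hj' := Finset.mem_range.1 (Finset.mem_filter.1 hj).1
        rcases Sym2.eq_iff.1 hij with h | h
        · exact hinj i j (by omega) (by omega) h.1
        · have h1 := hinj i (j + 1) (by omega) (by omega) h.1
          have h2 := hinj (i + 1) j (by omega) (by omega) h.2
          omega
    have h2 : ((Finset.range (n - 1)).filter fun i => x i ∈ W).card ≤ W.card := by
      refine Finset.card_le_card_of_injOn x (fun i hi => (Finset.mem_filter.1 hi).2) ?_
      intro i hi j hj hij
      have hi' := Finset.mem_range.1 (Finset.mem_filter.1 hi).1
      have hj' := Finset.mem_range.1 (Finset.mem_filter.1 hj).1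
      exact hinj i j (by omega) (by omega) hij
    have h3 : ((Finset.range (n - 1)).filter fun i => x (i + 1) ∈ W).card ≤ W.card := by
      refine Finset.card_le_card_of_injOn (fun i => x (i + 1))
        (fun i hi => (Finset.mem_filter.1 hi).2) ?_
      intro i hi j hj hij
      have hi' := Finset.mem_range.1 (Finset.mem_filter.1 hi).1
      have hj' := Finset.mem_range.1 (Finset.mem_filter.1 hj).1
      have := hinj (i + 1) (j + 1) (by omega) (by omega) hij
      omega
    have h4 := (Finset.card_le_card hcov).trans (Finset.card_union_le _ _)
    have h5 := Finset.card_union_le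
      ((Finset.range (n - 1)).filter fun i => s(x i, x (i + 1)) ∈ pairs P)
      (((Finset.range (n - 1)).filter fun i => x i ∈ W) ∪
          ((Finset.range (n - 1)).filter fun i => x (i + 1) ∈ W))
    have h6 := Finset.card_union_le ((Finset.range (n - 1)).filter fun i => x i ∈ W)
          ((Finset.range (n - 1)).filter fun i => x (i + 1) ∈ W)
    rw [Finset.card_range] at h4
    omega
  set f := J.orderEmbOfFin rfl with hf
  have hfJ : ∀ i, f i < n - 1 ∧ s(x (f i), x (f i + 1)) ∉ pairs P ∧ x (f i) ∉ W ∧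
      x (f i + 1) ∉ W := by
    intro i
    have h1 : f i ∈ J := J.orderEmbOfFin_mem rfl i
    have h2 := Finset.mem_filter.1 h1
    exact ⟨Finset.mem_range.1 h2.1, h2.2⟩
  have key : ∀ i j, i < j → ∃ h : x (f i) ≠ x (f j + 1),
      edge _ _ h ∉ P ∧ Avoids W (edge _ _ h) ∧ LinForest (pairs (insert (edge _ _ h) P)) := by
    intro i j hij
    have hlt : f i < f j := f.strictMono hij
    obtain ⟨hi1, hi2, hi3, hi4⟩ := hfJ i
    obtain ⟨hj1, hj2, hj3, hj4⟩ := hfJ j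
    set p := f i
    set q := f j
    have hne : x p ≠ x (q + 1) := fun h => by
      have := hinj _ _ (by omega) (by omega) h
      omega
    set X := l.take (p + 1) with hX
    set Y := (l.drop (p + 1)).take (q - p) with hY
    set Z := l.drop (q + 1) with hZ
    have hYZ : Y ++ Z = l.drop (p + 1) := by
      have h1 := List.take_append_drop (q - p) (l.drop (p + 1))
      rw [List.drop_drop, show p + 1 + (q - p) = q + 1 by omega] at h1
      exact h1
    have hXYZ : X ++ (Y ++ Z) = l := by
      rw [hYZ]; exact List.take_append_drop _ _
    have hXl : X.getLast? = some (x p) := by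
      rw [hX, List.getLast?_take]
      simp [hxi p (by omega)]
    have hYh : Y.head? = some (x (p + 1)) := by
      rw [hY, List.head?_take, if_neg (by omega), List.head?_drop, hxi _ (by omega)]
    have hYl : Y.getLast? = some (x q) := by
      rw [hY, List.getLast?_take, if_neg (by omega), List.getElem?_drop,
        show p + 1 + (q - p - 1) = q by omega, hxi _ (by omega)]
      simp
    have hZh : Z.head? = some (x (q + 1)) := by
      rw [hZ, List.head?_drop, hxi _ (by omega)]
    refine ⟨hne, ?_, ?_, Y ++ (X ++ Z), ?_, ?_⟩
    · rw [edge_mem_iff]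
      intro hmem
      have hns : ∀ u v, Follows l u v → ∃ k, k + 1 < n ∧ x k = u ∧ x (k + 1) = v := by
        rintro u v ⟨A, B, hAB⟩
        have hle : A.length + 2 + B.length = n := by
          have := congrArg List.length hAB
          rw [hlen] at this
          simp only [List.length_append, List.length_cons, List.length_nil] at this
          omega
        refine ⟨A.length, by omega, ?_, ?_⟩
        · have := hxi A.length (by omega)
          rw [← hAB] at this
          simpa using this.symm
        · have := hxi (A.length + 1) (by omega)
          rw [← hAB] at this
          simpa using this.symm
      rcases hc _ _ hmem with h | h
      · obtain ⟨k, h0, h1, h2⟩ := hns _ _ h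
        have e1 := hinj _ _ (by omega) (by omega) h1
        have e2 := hinj _ _ (by omega) (by omega) h2
        omega
      · obtain ⟨k, h0, h1, h2⟩ := hns _ _ h
        have e1 := hinj _ _ (by omega) (by omega) h1
        have e2 := hinj _ _ (by omega) (by omega) h2
        omega
    · intro v hv
      rcases Sym2.mem_iff.1 hv with rfl | rfl
      · exact hi3
      · exact hj4
    · refine hl.perm ?_
      rw [← hXYZ, ← List.append_assoc, ← List.append_assoc]
      exact List.perm_append_comm.append_right _
    · have h1 := carries_interchange (F := pairs P) (hXYZ.symm ▸ hc) hXl hYh hYl hZh hi2 hj2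
      intro a b hab
      refine h1 a b ?_
      obtain ⟨e, he, hab⟩ := hab
      rcases Finset.mem_insert.1 he with rfl | he
      · exact Or.inl hab.symm
      · exact Or.inr ⟨e, he, hab⟩
  choose hne hkey using key
  have hlow : ∀ i : Fin m, i.val < J.card := fun i => by omega
  have hhigh : ∀ j : Fin m, m + j.val < J.card := fun j => by omega
  have hij : ∀ i j : Fin m, (⟨i.val, hlow i⟩ : Fin J.card) < ⟨m + j.val, hhigh j⟩ := fun i j =>
    Fin.lt_def.2 (by simp only; omega)
  refine ⟨Finset.univ.image fun z : Fin m × Fin m => edge _ _ (hne _ _ (hij z.1 z.2)), ?_, ?_⟩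
  · rw [Finset.card_image_of_injective, Finset.card_univ, Fintype.card_prod, Fintype.card_fin, sq]
    rintro ⟨i, j⟩ ⟨i', j'⟩ h
    have hl1 : ∀ i j : Fin m, f ⟨i.val, hlow i⟩ < f ⟨m + j.val, hhigh j⟩ :=
      fun i j => f.strictMono (hij i j)
    have h' := congrArg Subtype.val h
    simp only [edge] at h'
    have b1 := (hfJ ⟨i.val, hlow i⟩).1
    have b2 := (hfJ ⟨i'.val, hlow i'⟩).1
    have b3 := (hfJ ⟨m + j.val, hhigh j⟩).1
    have b4 := (hfJ ⟨m + j'.val, hhigh j'⟩).1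
    rcases Sym2.eq_iff.1 h' with h | h
    · have e1 := hinj _ _ (by omega) (by omega) h.1
      have e2 := hinj _ _ (by omega) (by omega) h.2
      have e3 := f.injective e1
      have e4 := f.injective (Nat.succ_injective e2)
      simp only [Fin.mk.injEq] at e3 e4
      exact Prod.ext (Fin.ext e3) (Fin.ext (by simpa using e4))
    · have e1 := hinj _ _ (by omega) (by omega) h.1
      have e2 := hinj _ _ (by omega) (by omega) h.2
      have := hl1 i j
      have := hl1 i' j'
      omega
  · intro e he
    obtain ⟨z, -, rfl⟩ := Finset.mem_image.1 he
    exact hkey _ _ (hij z.1 z.2)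

/-- Every edge of a linear forest saves a break. -/
theorem breaks_add_card_le {n : ℕ} {G : SimpleGraph (Fin n)} {l : List (Fin n)}
    {P : Finset (CEdge n)} (hPG : ∀ a b, s(a, b) ∈ pairs P → G.Adj a b) (hc : Carries (pairs P) l)
    (hl : l ≠ []) : breaks G l + P.card + 1 ≤ l.length := by
  induction l generalizing P with
  | nil => exact absurd rfl hl
  | cons x l ih =>
    cases l with
    | nil =>
      have : P = ∅ := by
        by_contra hne
        obtain ⟨e, he⟩ := Finset.nonempty_iff_ne_empty.2 hne
        obtain ⟨u, v, huv, rfl⟩ := exists_eq_edge e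
        rcases hc u v ⟨_, he, rfl⟩ with h | h <;>
        · have := h.length_le
          simp at this
      simp [this, breaks]
    | cons y l =>
      have hc' : Carries (pairs (P.filter fun e => e.val ≠ s(x, y))) (y :: l) := by
        have hf : ∀ a b, s(a, b) ≠ s(x, y) → Follows (x :: y :: l) a b → Follows (y :: l) a b := by
          intro a b hne h
          rcases (follows_append (X := [x])).1 h with h | h | h
          · have := h.length_le; simp at this
          · exact h
          · simp only [List.getLast?_singleton, List.head?_cons, Option.some.injEq] at h
            exact absurd (by rw [h.1, h.2]) hne
        rintro a b ⟨e, he, hab⟩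
        obtain ⟨he1, he2⟩ := Finset.mem_filter.1 he
        rw [hab] at he2
        rcases hc a b ⟨e, he1, hab⟩ with h | h
        · exact Or.inl (hf a b he2 h)
        · exact Or.inr (hf b a (by rwa [Sym2.eq_swap]) h)
      have h1 := ih (P := P.filter fun e => e.val ≠ s(x, y))
        (fun a b hab => hPG a b (by
          obtain ⟨e, he, h⟩ := hab
          exact ⟨e, (Finset.mem_filter.1 he).1, h⟩)) hc' (by simp)
      rw [breaks]
      by_cases hxy : s(x, y) ∈ pairs P
      · rw [if_pos (hPG x y hxy)]
        obtain ⟨e, he, h⟩ := hxy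
        have h2 : P ⊆ insert e (P.filter fun e => e.val ≠ s(x, y)) := by
          intro e' he'
          by_cases h' : e'.val = s(x, y)
          · exact Finset.mem_insert.2 (Or.inl (Subtype.ext (h'.trans h.symm)))
          · exact Finset.mem_insert_of_mem (Finset.mem_filter.2 ⟨he', h'⟩)
        have h3 := (Finset.card_le_card h2).trans (Finset.card_insert_le _ _)
        simp only [List.length_cons] at h1 ⊢
        omega
      · have h2 : (P.filter fun e => e.val ≠ s(x, y)) = P := by
          refine Finset.filter_true_of_mem fun e he h => hxy ⟨e, he, h⟩
        rw [h2] at h1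
        simp only [List.length_cons] at h1 ⊢
        split_ifs <;> omega

/-- The degree of `v` in the graph with edge set `P`. -/
noncomputable def vdeg {n : ℕ} (P : Finset (CEdge n)) (v : Fin n) : ℕ :=
  (P.filter fun e => v ∈ e.val).card

theorem vdeg_le_two {n : ℕ} {P : Finset (CEdge n)} (hF : LinForest (pairs P)) (v : Fin n) :
    vdeg P v ≤ 2 := by
  obtain ⟨l, hl, hc⟩ := hF
  unfold vdeg
  by_contra! hlt
  obtain ⟨e1, h1, e2, h2, e3, h3, h12, h13, h23⟩ := Finset.two_lt_card.1 hlt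
  have hsplit : ∀ e ∈ P.filter (fun e => v ∈ e.val),
      ∃ y, e.val = s(v, y) ∧ (Follows l v y ∨ Follows l y v) := by
    intro e he
    obtain ⟨he1, he2⟩ := Finset.mem_filter.1 he
    obtain ⟨y, hy⟩ := he2
    exact ⟨y, hy, hc v y ⟨e, he1, hy⟩⟩
  obtain ⟨y1, hy1, f1⟩ := hsplit e1 h1
  obtain ⟨y2, hy2, f2⟩ := hsplit e2 h2
  obtain ⟨y3, hy3, f3⟩ := hsplit e3 h3
  have n12 : y1 ≠ y2 := fun h => h12 (Subtype.ext (by rw [hy1, hy2, h]))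
  have n13 : y1 ≠ y3 := fun h => h13 (Subtype.ext (by rw [hy1, hy3, h]))
  have n23 : y2 ≠ y3 := fun h => h23 (Subtype.ext (by rw [hy2, hy3, h]))
  have hr : ∀ {y z}, Follows l v y → Follows l v z → y = z := fun h h' => h.eq_right hl.1 h'
  have hl : ∀ {y z}, Follows l y v → Follows l z v → y = z := fun h h' => h.eq_left hl.1 h'
  rcases f1 with f1 | f1 <;> rcases f2 with f2 | f2 <;> rcases f3 with f3 | f3
  · exact n12 (hr f1 f2)
  · exact n12 (hr f1 f2)
  · exact n13 (hr f1 f3)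
  · exact n23 (hl f2 f3)
  · exact n23 (hr f2 f3)
  · exact n13 (hl f1 f3)
  · exact n12 (hl f1 f2)
  · exact n12 (hl f1 f2)

theorem sum_vdeg {n : ℕ} (P : Finset (CEdge n)) : ∑ v, vdeg P v = 2 * P.card := by
  unfold vdeg
  simp_rw [Finset.card_filter]
  rw [Finset.sum_comm, Finset.sum_const_nat (m := 2), mul_comm]
  intro e _
  obtain ⟨u, v, huv, rfl⟩ := exists_eq_edge e
  rw [← Finset.card_filter]
  have : (Finset.univ.filter fun w => w ∈ (edge u v huv).val) = {u, v} := by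
    ext w
    simp [edge]
  rw [this, Finset.card_pair huv]

theorem card_low_degree_le {n k : ℕ} {P : Finset (CEdge n)} (hF : LinForest (pairs P))
    (hP : n ≤ P.card + k) :
    (Finset.univ.filter fun v => vdeg P v ≤ 1).card ≤ 2 * k := by
  have h1 : ∑ v : Fin n, ((if vdeg P v ≤ 1 then 1 else 0) + vdeg P v) ≤
      ∑ _v : Fin n, 2 := by
    refine Finset.sum_le_sum fun v _ => ?_
    have := vdeg_le_two hF v
    split_ifs <;> omega
  rw [Finset.sum_add_distrib, sum_vdeg, ← Finset.card_filter] at h1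
  simp only [Finset.sum_const, Finset.card_univ, Fintype.card_fin, smul_eq_mul] at h1
  omega

end LinearForests

section Ownership

/-- The vertices reserved for connecting the paths of the linear forest. -/
def hub (n m : ℕ) : Finset (Fin n) := Finset.univ.filter fun v => v.val < 3 * m

/-- The vertex `v` owns the pair `{v, x}`.  Every owned pair has an endpoint in the hub and a unique
owner, and every vertex owns the same number of pairs. -/
def Own {n : ℕ} (m : ℕ) (v x : Fin n) : Prop :=
  x.val < 3 * m ∧ if v.val < 3 * m then x.val % 3 = (v.val + 1) % 3 else x.val % 3 = 0

theorem mem_hub {n m : ℕ} {v : Fin n} : v ∈ hub n m ↔ v.val < 3 * m := by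
  simp [hub]

theorem card_hub_le (n m : ℕ) : (hub n m).card ≤ 3 * m := by
  rw [← Finset.card_range (3 * m)]
  refine Finset.card_le_card_of_injOn Fin.val (fun v hv => ?_) Fin.val_injective.injOn
  simpa [hub] using hv

theorem Own.mem_hub {n m : ℕ} {v x : Fin n} (h : Own m v x) : x ∈ hub n m :=
  _root_.mem_hub.2 h.1

theorem Own.asymm {n m : ℕ} {v x : Fin n} (h : Own m v x) : ¬ Own m x v := by
  intro h'
  obtain ⟨h1, h2⟩ := h
  obtain ⟨h3, h4⟩ := h'
  rw [if_pos h3] at h2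
  rw [if_pos h1] at h4
  omega

theorem Own.ne {n m : ℕ} {v x : Fin n} (h : Own m v x) : v ≠ x := by
  rintro rfl
  exact h.asymm h

theorem Own.unique {n m : ℕ} {v x v' x' : Fin n} (h : Own m v x) (h' : Own m v' x')
    (he : s(v, x) = s(v', x')) : v = v' ∧ x = x' := by
  rcases Sym2.eq_iff.1 he with h1 | ⟨rfl, rfl⟩
  · exact h1
  · exact absurd h' h.asymm

theorem card_residue {n m : ℕ} (hm : 3 * m ≤ n) (c : ℕ) (hc : c < 3) :
    (Finset.univ.filter fun x : Fin n => x.val < 3 * m ∧ x.val % 3 = c).card = m := by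
  have h : (Finset.univ.filter fun x : Fin n => x.val < 3 * m ∧ x.val % 3 = c) =
      Finset.univ.image fun k : Fin m => (⟨3 * k.val + c, by omega⟩ : Fin n) := by
    ext x
    simp only [Finset.mem_filter, Finset.mem_univ, true_and, Finset.mem_image, Fin.ext_iff]
    constructor
    · rintro ⟨h1, h2⟩
      exact ⟨⟨x.val / 3, by omega⟩, by simp only; omega⟩
    · rintro ⟨k, hk⟩
      omega
  rw [h, Finset.card_image_of_injective, Finset.card_univ, Fintype.card_fin]
  intro a b hab
  simp only [Fin.mk.injEq] at hab
  exact Fin.ext (by omega)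

theorem card_own {n m : ℕ} (hm : 3 * m ≤ n) (v : Fin n) :
    (Finset.univ.filter fun x => Own m v x).card = m := by
  unfold Own
  by_cases hv : v.val < 3 * m
  · simp only [if_pos hv]
    exact card_residue hm _ (Nat.mod_lt _ (by norm_num))
  · simp only [if_neg hv]
    exact card_residue hm 0 (by norm_num)

/-- The number of edges of `P` owned by `v`. -/
noncomputable def odeg {n : ℕ} (m : ℕ) (P : Finset (CEdge n)) (v : Fin n) : ℕ :=
  (Finset.univ.filter fun x => Own m v x ∧ s(v, x) ∈ pairs P).card

theorem pairs_insert {n : ℕ} {P : Finset (CEdge n)} {e : CEdge n} {z : Sym2 (Fin n)} :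
    z ∈ pairs (insert e P) ↔ z = e.val ∨ z ∈ pairs P := by
  unfold pairs
  simp only [Finset.mem_insert, Set.mem_ofPred_eq, exists_eq_or_imp]
  rw [eq_comm]

theorem pairs_mono {n : ℕ} {P Q : Finset (CEdge n)} (h : P ⊆ Q) : pairs P ⊆ pairs Q := by
  rintro z ⟨e, he, h1⟩
  exact ⟨e, h he, h1⟩

theorem mem_pairs {n : ℕ} {P : Finset (CEdge n)} {e : CEdge n} : e.val ∈ pairs P ↔ e ∈ P :=
  ⟨fun ⟨e', he', h⟩ => by rwa [← Subtype.ext h], fun h => ⟨e, h, rfl⟩⟩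

theorem odeg_mono {n m : ℕ} {P Q : Finset (CEdge n)} (h : P ⊆ Q) (v : Fin n) :
    odeg m P v ≤ odeg m Q v := by
  refine Finset.card_le_card fun x hx => ?_
  simp only [Finset.mem_filter, Finset.mem_univ, true_and] at hx ⊢
  exact ⟨hx.1, pairs_mono h hx.2⟩

theorem odeg_insert_own {n m : ℕ} {P : Finset (CEdge n)} {e : CEdge n} {v x : Fin n}
    (h : Own m v x) (he : e.val = s(v, x)) (heP : e ∉ P) :
    odeg m (insert e P) v = odeg m P v + 1 := by
  unfold odeg
  rw [← Finset.card_insert_of_notMem (a := x)]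
  · congr 1
    ext y
    simp only [Finset.mem_filter, Finset.mem_univ, true_and, Finset.mem_insert, pairs_insert, he]
    constructor
    · rintro ⟨h1, h2 | h2⟩
      · exact Or.inl (h1.unique h h2).2
      · exact Or.inr ⟨h1, h2⟩
    · rintro (rfl | h1)
      · exact ⟨h, Or.inl rfl⟩
      · exact ⟨h1.1, Or.inr h1.2⟩
  · simp only [Finset.mem_filter, Finset.mem_univ, true_and, ← he, mem_pairs]
    exact fun h1 => heP h1.2

theorem odeg_insert_of_not_own {n m : ℕ} {P : Finset (CEdge n)} {e : CEdge n} {v : Fin n}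
    (h : ∀ x, Own m v x → e.val ≠ s(v, x)) : odeg m (insert e P) v = odeg m P v := by
  unfold odeg
  congr 1
  ext y
  simp only [Finset.mem_filter, Finset.mem_univ, true_and, pairs_insert]
  constructor
  · rintro ⟨h1, h2 | h2⟩
    · exact absurd h2.symm (h y h1)
    · exact ⟨h1, h2⟩
  · rintro ⟨h1, h2⟩
    exact ⟨h1, Or.inr h2⟩

theorem card_own_unseen {n m : ℕ} (hm : 3 * m ≤ n) (T : Finset (CEdge n)) (v : Fin n) :
    (Finset.univ.filter fun x => Own m v x ∧ s(v, x) ∉ pairs T).card + odeg m T v = m := by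
  unfold odeg
  rw [← Finset.card_union_of_disjoint]
  · refine Eq.trans ?_ (card_own hm v)
    congr 1
    ext x
    simp only [Finset.mem_filter, Finset.mem_univ, true_and, Finset.mem_union]
    tauto
  · rw [Finset.disjoint_left]
    intro x hx hx'
    exact (Finset.mem_filter.1 hx).2.2 (Finset.mem_filter.1 hx').2.2

/-- A drift estimate for quantities that change only when an owned pair is revealed. -/
theorem sum_unseen_le {n m : ℕ} {T : Finset (CEdge n)} {R : Finset (Fin n)}
    {w : Fin n → Fin n → ℝ} {g : CEdge n → ℝ} {z c : ℝ} (hz : 0 ≤ z)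
    (h1 : ∀ e ∉ T, (∀ v ∈ R, ∀ x, Own m v x → e.val ≠ s(v, x)) → g e ≤ z)
    (h2 : ∀ v ∈ R, ∀ x, Own m v x → ∀ e ∉ T, e.val = s(v, x) → g e ≤ z * (1 + w v x))
    (h3 : ∀ v ∈ R, ∑ x ∈ Finset.univ.filter (fun x => Own m v x ∧ s(v, x) ∉ pairs T), w v x ≤ c) :
    ∑ e ∈ Tᶜ, g e ≤ z * ((Tᶜ.card : ℝ) + R.card * c) := by
  have hpt : ∀ e ∈ Tᶜ, g e ≤ z * (1 + ∑ v ∈ R, ∑ x ∈ Finset.univ.filter (fun x => Own m v x),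
      if e.val = s(v, x) then w v x else 0) := by
    intro e he
    rw [Finset.mem_compl] at he
    by_cases hex : ∃ v ∈ R, ∃ x, Own m v x ∧ e.val = s(v, x)
    · obtain ⟨v, hv, x, hvx, hex⟩ := hex
      have hsum : (∑ v ∈ R, ∑ x ∈ Finset.univ.filter (fun x => Own m v x),
          if e.val = s(v, x) then w v x else 0) = w v x := by
        rw [Finset.sum_eq_single_of_mem v hv, Finset.sum_eq_single_of_mem x (by simpa using hvx),
          if_pos hex]
        · intro y hy hne
          rw [if_neg]
          intro h
          exact hne ((Finset.mem_filter.1 hy).2.unique hvx (h.symm.trans hex)).2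
        · intro u _ hne
          refine Finset.sum_eq_zero fun y hy => if_neg fun h => ?_
          exact hne ((Finset.mem_filter.1 hy).2.unique hvx (h.symm.trans hex)).1
      rw [hsum]
      exact h2 v hv x hvx e he hex
    · push Not at hex
      have hsum : (∑ v ∈ R, ∑ x ∈ Finset.univ.filter (fun x => Own m v x),
          if e.val = s(v, x) then w v x else 0) = 0 :=
        Finset.sum_eq_zero fun v hv => Finset.sum_eq_zero fun x hx =>
          if_neg (hex v hv x (Finset.mem_filter.1 hx).2)
      rw [hsum, add_zero, mul_one]
      exact h1 e he hex
  refine (Finset.sum_le_sum hpt).trans ?_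
  rw [← Finset.mul_sum]
  refine mul_le_mul_of_nonneg_left ?_ hz
  rw [Finset.sum_add_distrib, Finset.sum_const, nsmul_eq_mul, mul_one]
  refine add_le_add le_rfl ?_
  rw [Finset.sum_comm, ← nsmul_eq_mul]
  refine Finset.sum_le_card_nsmul _ _ _ fun v hv => le_trans (le_of_eq ?_) (h3 v hv)
  rw [Finset.sum_comm, ← Finset.filter_filter, Finset.sum_filter (p := fun x => s(v, x) ∉ pairs T)]
  refine Finset.sum_congr rfl fun x hx => ?_
  have hne := (Finset.mem_filter.1 hx).2.ne
  have hiff : ∀ e : CEdge n, e.val = s(v, x) ↔ e = edge v x hne := fun e =>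
    ⟨fun h => Subtype.ext h, fun h => by rw [h]; rfl⟩
  simp only [hiff]
  rw [Finset.sum_ite_eq']
  simp only [Finset.mem_compl, edge_mem_iff]

end Ownership

section Connectors

/-- The edges of `P` away from the hub. -/
noncomputable def base {n : ℕ} (m : ℕ) (P : Finset (CEdge n)) : Finset (CEdge n) :=
  P.filter fun e => Avoids (hub n m) e

/-- The vertices that are in the hub or have at most one edge away from the hub. -/
noncomputable def deficient {n : ℕ} (m : ℕ) (P : Finset (CEdge n)) : Finset (Fin n) :=
  Finset.univ.filter fun v => v ∈ hub n m ∨ vdeg (base m P) v ≤ 1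

/-- `e` is owned by a deficient vertex that has fewer than five owned edges. -/
def IsConnector {n : ℕ} (m : ℕ) (P : Finset (CEdge n)) (e : CEdge n) : Prop :=
  ∃ v x, e.val = s(v, x) ∧ Own m v x ∧ v ∈ deficient m P ∧ odeg m P v < 5

/-- Builder purchases exactly the connectors between the times `a` and `b`. -/
def Connects {n : ℕ} (m : ℕ) (S : Strategy n) (a b : ℕ) : Prop :=
  ∀ s, a ≤ s → s < b → ∀ P e, S s P e = true ↔ IsConnector m P e

theorem base_insert {n m : ℕ} {P : Finset (CEdge n)} {e : CEdge n} (h : ¬ Avoids (hub n m) e) :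
    base m (insert e P) = base m P := by
  unfold base
  rw [Finset.filter_insert, if_neg h]

theorem IsConnector.not_avoids {n m : ℕ} {P : Finset (CEdge n)} {e : CEdge n}
    (h : IsConnector m P e) : ¬ Avoids (hub n m) e := by
  obtain ⟨v, x, he, hvx, -⟩ := h
  intro ha
  exact ha x (by rw [he]; simp) hvx.mem_hub

theorem Connects.base_next {n m a b : ℕ} {S : Strategy n} (hS : Connects m S a b) {s : ℕ}
    (ha : a ≤ s) (hb : s < b) (P : Finset (CEdge n)) (e : CEdge n) :
    base m (nextGraph S s P e) = base m P := by
  unfold nextGraph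
  split_ifs with h
  · exact base_insert ((hS s ha hb P e).1 h).not_avoids
  · rfl

theorem Connects.deficient_next {n m a b : ℕ} {S : Strategy n} (hS : Connects m S a b) {s : ℕ}
    (ha : a ≤ s) (hb : s < b) (P : Finset (CEdge n)) (e : CEdge n) :
    deficient m (nextGraph S s P e) = deficient m P := by
  unfold deficient
  rw [hS.base_next ha hb]

theorem Connects.next_eq {n m a b : ℕ} {S : Strategy n} (hS : Connects m S a b) {s : ℕ}
    (ha : a ≤ s) (hb : s < b) {P : Finset (CEdge n)} {e : CEdge n} {v x : Fin n}
    (he : e.val = s(v, x)) (hvx : Own m v x) (hv : v ∈ deficient m P) (h5 : odeg m P v < 5) :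
    nextGraph S s P e = insert e P := by
  unfold nextGraph
  rw [if_pos ((hS s ha hb P e).2 ⟨v, x, he, hvx, hv, h5⟩)]

theorem odeg_next_of_not_own {n m : ℕ} (S : Strategy n) (s : ℕ) {P : Finset (CEdge n)}
    {e : CEdge n} {v : Fin n} (h : ∀ x, Own m v x → e.val ≠ s(v, x)) :
    odeg m (nextGraph S s P e) v = odeg m P v := by
  unfold nextGraph
  split_ifs
  · exact odeg_insert_of_not_own h
  · rfl

/-- No vertex sees many more owned edges than expected. -/
theorem uprob_owned_large {n m : ℕ} (S : Strategy n) (hm : 3 * m ≤ n) (hn : 0 < n) (v : Fin n)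
    {t : ℕ} (ht : t ≤ Fintype.card (CEdge n))
    (hN : (n : ℝ) ^ 2 / 4 ≤ Fintype.card (CEdge n) - t) :
    uprob (fun ω : EdgeOrdering n => m < 2 * odeg m (seen ω t) v) ≤
      (1 + 4 / (n : ℝ)) ^ t / 2 ^ (m / 2) := by
  have hn0 : (0 : ℝ) < n := by exact_mod_cast hn
  refine (uprob_le_mean_div (f := fun ω => (2 : ℝ) ^ odeg m (seen ω t) v) (c := 2 ^ (m / 2))
    (by positivity) (fun ω => by positivity)
    (fun ω h => pow_le_pow_right₀ (by norm_num) (by omega))).trans ?_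
  refine div_le_div_of_nonneg_right ?_ (by positivity)
  refine (mean_drift S (fun _ T _ => (2 : ℝ) ^ odeg m T v) (r := 1 + 4 / (n : ℝ))
    (by positivity) (Nat.zero_le t) ht ?_).trans ?_
  · intro s _ hst ω
    refine (sum_unseen_le (m := m) (R := {v}) (w := fun _ _ => 1) (c := m)
      (z := 2 ^ odeg m (seen ω s) v) (by positivity) ?_ ?_ ?_).trans ?_
    · intro e he h
      rw [odeg_insert_of_not_own (h v (by simp))]
    · intro u hu x hux e he hex
      rw [Finset.mem_singleton] at hu
      subst hu
      rw [odeg_insert_own hux hex he, pow_succ]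
      norm_num
    · intro u _
      rw [Finset.sum_const, nsmul_eq_mul, mul_one]
      have := card_own_unseen hm (seen ω s) u
      exact_mod_cast (by omega : (Finset.univ.filter fun x => Own m u x ∧
        s(u, x) ∉ pairs (seen ω s)).card ≤ m)
    · rw [card_unseen ω (by omega), Finset.card_singleton, mul_comm]
      refine mul_le_mul_of_nonneg_right ?_ (by positivity)
      have h1 : (s : ℝ) ≤ t := by exact_mod_cast hst.le
      have h2 : (3 * m : ℝ) ≤ n := by exact_mod_cast hm
      have h3 : (n : ℝ) ≤ 4 / n * (Fintype.card (CEdge n) - s) := by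
        calc (n : ℝ) = 4 / n * ((n : ℝ) ^ 2 / 4) := by field_simp
          _ ≤ _ := mul_le_mul_of_nonneg_left (by linarith) (by positivity)
      have h4 : (0 : ℝ) ≤ m := Nat.cast_nonneg _
      push_cast
      linarith
  · rw [Nat.sub_zero]
    refine mul_le_of_le_one_right (by positivity) (mean_le_of_le zero_le_one fun ω => ?_)
    have : odeg m (seen ω 0) v = 0 := by
      simp [odeg, seen, pairs]
    rw [this, pow_zero]

/-- Deficient vertices acquire their connectors. -/
theorem uprob_unsaturated {n m a b : ℕ} {S : Strategy n} (hS : Connects m S a b) (hm : 3 * m ≤ n)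
    (hn : 0 < n) (v : Fin n) (hab : a ≤ b) (hb : b ≤ Fintype.card (CEdge n)) :
    uprob (fun ω : EdgeOrdering n => v ∈ deficient m (process S ω b) ∧
      odeg m (process S ω b) v < 5 ∧ 2 * odeg m (seen ω b) v ≤ m) ≤
      (1 - m / (2 * (n : ℝ) ^ 2)) ^ (b - a) * 32 := by
  have hn0 : (0 : ℝ) < n := by exact_mod_cast hn
  have hn1 : (1 : ℝ) ≤ n := by exact_mod_cast hn
  have hm0 : (0 : ℝ) ≤ m := Nat.cast_nonneg _
  have hmn : (3 * m : ℝ) ≤ n := by exact_mod_cast hm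
  have hr : 0 ≤ 1 - m / (2 * (n : ℝ) ^ 2) := by
    have : m / (2 * (n : ℝ) ^ 2) ≤ 1 := by
      rw [div_le_one (by positivity)]
      nlinarith
    linarith
  set φ : Finset (CEdge n) → Finset (CEdge n) → Finset (CEdge n) → ℝ := fun _ T P =>
    if v ∈ deficient m P ∧ odeg m P v < 5 ∧ 2 * odeg m T v ≤ m then 2 ^ (5 - odeg m P v) else 0
    with hφ
  have hφ0 : ∀ A T P, 0 ≤ φ A T P := fun A T P => by
    simp only [hφ]
    split_ifs <;> positivity
  have hφle : ∀ A T P, φ A T P ≤ 2 ^ (5 - odeg m P v) := fun A T P => by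
    simp only [hφ]
    split_ifs
    · exact le_rfl
    · positivity
  refine (uprob_le_mean (f := fun ω => φ (process S ω a) (seen ω b) (process S ω b))
    (fun ω => hφ0 (process S ω a) _ _) (fun ω h => ?_)).trans ?_
  · simp only [hφ]
    rw [if_pos h]
    exact one_le_pow₀ (by norm_num)
  refine (mean_drift S φ hr hab hb ?_).trans ?_
  · intro s has hsb ω
    set P := process S ω s
    set T := seen ω s
    have hPT : P ⊆ T := process_subset_seen S ω s
    by_cases hC : v ∈ deficient m P ∧ odeg m P v < 5 ∧ 2 * odeg m T v ≤ m
    · have hz : φ (process S ω a) T P = 2 ^ (5 - odeg m P v) := by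
        simp only [hφ]
        rw [if_pos hC]
      rw [hz]
      refine (sum_unseen_le (m := m) (R := {v}) (w := fun _ _ => -1 / 2) (c := -m / 4)
        (z := 2 ^ (5 - odeg m P v)) (by positivity) ?_ ?_ ?_).trans ?_
      · intro e he h
        refine (hφle (process S ω a) _ _).trans ?_
        rw [odeg_next_of_not_own S s (h v (by simp))]
      · intro u hu x hux e he hex
        rw [Finset.mem_singleton] at hu
        subst hu
        refine (hφle (process S ω a) _ _).trans ?_
        rw [hS.next_eq has hsb hex hux hC.1 hC.2.1,
          odeg_insert_own hux hex fun h => he (hPT h)]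
        rw [show 5 - odeg m P u = (5 - (odeg m P u + 1)) + 1 by have := hC.2.1; omega, pow_succ]
        refine le_of_eq ?_
        ring
      · intro u hu
        rw [Finset.mem_singleton] at hu
        subst hu
        rw [Finset.sum_const, nsmul_eq_mul]
        have h1 := card_own_unseen hm T u
        have h2 := hC.2.2
        have h3 : m ≤ 2 * (Finset.univ.filter fun x => Own m u x ∧ s(u, x) ∉ pairs T).card := by
          omega
        have h4 : (m : ℝ) ≤
            2 * ((Finset.univ.filter fun x => Own m u x ∧ s(u, x) ∉ pairs T).card : ℝ) := by
          exact_mod_cast h3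
        linarith
      · rw [card_unseen ω (by omega), Finset.card_singleton, mul_comm]
        refine mul_le_mul_of_nonneg_right ?_ (by positivity)
        have h1 := card_cedge_le n
        have h2 : (0 : ℝ) ≤ s := Nat.cast_nonneg _
        have h3 : m / (2 * (n : ℝ) ^ 2) * (Fintype.card (CEdge n) - s) ≤ m / 4 := by
          calc m / (2 * (n : ℝ) ^ 2) * (Fintype.card (CEdge n) - s)
              ≤ m / (2 * (n : ℝ) ^ 2) * ((n : ℝ) ^ 2 / 2) :=
                mul_le_mul_of_nonneg_left (by linarith) (by positivity)
            _ = m / 4 := by field_simp; norm_num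
        push_cast
        linarith
    · have hz : φ (process S ω a) T P = 0 := by
        simp only [hφ]
        rw [if_neg hC]
      rw [hz, mul_zero]
      refine Finset.sum_nonpos fun e _ => le_of_eq ?_
      simp only [hφ]
      rw [if_neg]
      rintro ⟨h1, h2, h3⟩
      rw [hS.deficient_next has hsb] at h1
      have h4 := odeg_mono (m := m) (subset_nextGraph S s P e) v
      have h5 := odeg_mono (m := m) (Finset.subset_insert e T) v
      exact hC ⟨h1, by omega, by omega⟩
  · refine mul_le_mul_of_nonneg_left (mean_le_of_le (by norm_num) fun ω => ?_) (pow_nonneg hr _)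
    refine (hφle (process S ω a) _ _).trans ?_
    calc (2 : ℝ) ^ (5 - odeg m (process S ω a) v) ≤ 2 ^ 5 :=
          pow_le_pow_right₀ (by norm_num) (by omega)
      _ = 32 := by norm_num

/-- The connectors of a small set of deficient vertices do not end in a small set. -/
theorem uprob_confined {n m a b k : ℕ} {S : Strategy n} (hS : Connects m S a b) (hm : 3 * m ≤ n)
    (hab : a ≤ b) (hb : b ≤ Fintype.card (CEdge n)) (hk : 0 < k) (hkm : 6 * k ≤ m)
    (hstart : ∀ (ω : EdgeOrdering n) (v : Fin n), odeg m (process S ω a) v = 0)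
    {X U : Finset (Fin n)} (hX : X.card = k) (hU : U.card ≤ 3 * k) :
    uprob (fun ω : EdgeOrdering n => X ⊆ deficient m (process S ω b) ∧
      (∀ v ∈ X, 2 * odeg m (seen ω b) v ≤ m) ∧ (∀ v ∈ X, 5 ≤ odeg m (process S ω b) v) ∧
      ∀ v ∈ X, ∀ x, Own m v x → s(v, x) ∈ pairs (process S ω b) → x ∈ U) ≤
      1 / ((m : ℝ) / (6 * k)) ^ (5 * k) := by
  have hk0 : (0 : ℝ) < k := by exact_mod_cast hk
  have hm0 : (0 : ℝ) < m := by
    have : 0 < m := by omega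
    exact_mod_cast this
  have hkm' : (6 * k : ℝ) ≤ m := by exact_mod_cast hkm
  set κ : ℝ := m / (6 * k) with hκ
  have hκ1 : 1 ≤ κ := (one_le_div (by positivity)).2 hkm'
  have hκ0 : 0 < κ := by linarith
  set C : Finset (CEdge n) → Finset (CEdge n) → Prop := fun T P => X ⊆ deficient m P ∧
    (∀ v ∈ X, 2 * odeg m T v ≤ m) ∧
    ∀ v ∈ X, ∀ x, Own m v x → s(v, x) ∈ pairs P → x ∈ U with hCdef
  set φ : Finset (CEdge n) → Finset (CEdge n) → Finset (CEdge n) → ℝ := fun _ T P =>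
    if C T P then κ ^ (∑ v ∈ X, odeg m P v) else 0 with hφ
  have hφ0 : ∀ A T P, 0 ≤ φ A T P := fun A T P => by
    simp only [hφ]
    split_ifs <;> positivity
  have hφle : ∀ A T P, φ A T P ≤ κ ^ (∑ v ∈ X, odeg m P v) := fun A T P => by
    simp only [hφ]
    split_ifs
    · exact le_rfl
    · positivity
  refine (uprob_le_mean_div (f := fun ω => φ (process S ω a) (seen ω b) (process S ω b))
    (c := κ ^ (5 * k)) (by positivity) (fun ω => hφ0 (process S ω a) _ _) (fun ω h => ?_)).trans ?_
  · simp only [hφ]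
    rw [if_pos ⟨h.1, h.2.1, h.2.2.2⟩]
    refine pow_le_pow_right₀ hκ1 ?_
    rw [← hX, mul_comm, ← smul_eq_mul]
    exact Finset.card_nsmul_le_sum _ _ _ h.2.2.1
  refine div_le_div_of_nonneg_right ?_ (by positivity)
  refine (mean_drift S φ zero_le_one hab hb ?_).trans ?_
  · intro s has hsb ω
    set P := process S ω s
    set T := seen ω s
    have hPT : P ⊆ T := process_subset_seen S ω s
    by_cases hC : C T P
    · have hz : φ (process S ω a) T P = κ ^ (∑ v ∈ X, odeg m P v) := by
        simp only [hφ]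
        rw [if_pos hC]
      rw [hz]
      refine (sum_unseen_le (m := m) (R := X.filter fun v => odeg m P v < 5)
        (w := fun _ x => (if x ∈ U then κ else 0) - 1) (c := 0)
        (z := κ ^ (∑ v ∈ X, odeg m P v)) (by positivity) ?_ ?_ ?_).trans ?_
      · intro e he h
        refine (hφle (process S ω a) _ _).trans (le_of_eq ?_)
        congr 1
        refine Finset.sum_congr rfl fun v hv => ?_
        by_cases h5 : odeg m P v < 5
        · exact odeg_next_of_not_own S s (h v (Finset.mem_filter.2 ⟨hv, h5⟩))
        · by_cases hown : ∃ x, Own m v x ∧ e.val = s(v, x)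
          · obtain ⟨x, hvx, hex⟩ := hown
            unfold nextGraph
            rw [if_neg]
            rw [hS s has hsb]
            rintro ⟨u, y, he', huy, -, h5'⟩
            obtain ⟨rfl, -⟩ := hvx.unique huy (hex.symm.trans he')
            exact h5 h5'
          · push Not at hown
            exact odeg_next_of_not_own S s hown
      · intro u hu x hux e he hex
        obtain ⟨huX, h5⟩ := Finset.mem_filter.1 hu
        have hnext := hS.next_eq has hsb hex hux (hC.1 huX) h5
        rw [hnext]
        by_cases hxU : x ∈ U
        · refine (hφle (process S ω a) _ _).trans (le_of_eq ?_)
          rw [if_pos hxU, add_sub_cancel, ← pow_succ]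
          congr 1
          rw [← Finset.add_sum_erase _ _ huX, ← Finset.add_sum_erase X (fun v => odeg m P v) huX,
            odeg_insert_own hux hex fun h => he (hPT h)]
          rw [Finset.sum_congr rfl fun v hv => odeg_insert_of_not_own (m := m) (P := P) (e := e) ?_]
          · ring
          · intro y hvy hey
            exact (Finset.mem_erase.1 hv).1 (hvy.unique hux (hey.symm.trans hex)).1
        · rw [if_neg hxU]
          simp only [hφ]
          rw [if_neg]
          · simp
          · rintro ⟨-, -, h⟩
            exact hxU (h u huX x hux (pairs_insert.2 (Or.inl hex.symm)))
      · intro u hu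
        obtain ⟨huX, h5⟩ := Finset.mem_filter.1 hu
        rw [Finset.sum_sub_distrib, ← Finset.sum_filter, Finset.sum_const, Finset.sum_const,
          nsmul_eq_mul, nsmul_eq_mul, mul_one]
        set Z := Finset.univ.filter fun x => Own m u x ∧ s(u, x) ∉ pairs T with hZ
        have h1 : Z.card + odeg m T u = m := card_own_unseen hm T u
        have h2 := hC.2.1 u huX
        have h3 : m ≤ 2 * Z.card := by omega
        have h4 : (m : ℝ) ≤ 2 * (Z.card : ℝ) := by exact_mod_cast h3
        have h5 : (Z.filter fun x => x ∈ U).card ≤ 3 * k :=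
          (Finset.card_le_card fun x hx => (Finset.mem_filter.1 hx).2).trans hU
        have h6 : ((Z.filter fun x => x ∈ U).card : ℝ) ≤ 3 * k := by exact_mod_cast h5
        have h7 : ((Z.filter fun x => x ∈ U).card : ℝ) * κ ≤ 3 * k * κ :=
          mul_le_mul_of_nonneg_right h6 hκ0.le
        have h8 : 3 * k * κ = m / 2 := by
          rw [hκ]; field_simp; norm_num
        linarith
      · rw [card_unseen ω (by omega), mul_zero, add_zero, one_mul, mul_comm]
    · have hz : φ (process S ω a) T P = 0 := by
        simp only [hφ]
        rw [if_neg hC]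
      rw [hz, mul_zero]
      refine Finset.sum_nonpos fun e _ => le_of_eq ?_
      simp only [hφ]
      rw [if_neg]
      rintro ⟨h1, h2, h3⟩
      rw [hS.deficient_next has hsb] at h1
      refine hC ⟨h1, fun v hv => ?_, fun v hv x hvx hx =>
        h3 v hv x hvx (pairs_mono (subset_nextGraph S s P e) hx)⟩
      have h5 := odeg_mono (m := m) (Finset.subset_insert e T) v
      have := h2 v hv
      omega
  · rw [one_pow, one_mul]
    refine mean_le_of_le zero_le_one fun ω => (hφle (process S ω a) _ _).trans ?_
    rw [Finset.sum_eq_zero fun v _ => hstart ω v, pow_zero]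

end Connectors

section Links

/-- `e` avoids the hub and extends the linear forest `P`. -/
def IsLink {n : ℕ} (m : ℕ) (P : Finset (CEdge n)) (e : CEdge n) : Prop :=
  Avoids (hub n m) e ∧ LinForest (pairs (insert e P))

/-- Builder purchases exactly the links between the times `a` and `b`. -/
def Links {n : ℕ} (m : ℕ) (S : Strategy n) (a b : ℕ) : Prop :=
  ∀ s, a ≤ s → s < b → ∀ P e, S s P e = true ↔ IsLink m P e

theorem Links.invariant {n m b : ℕ} {S : Strategy n} (hS : Links m S 0 b) (ω : EdgeOrdering n) :
    (∀ e ∈ process S ω b, Avoids (hub n m) e) ∧ LinForest (pairs (process S ω b)) := by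
  refine process_invariant (a := 0) (p := fun P : Finset (CEdge n) =>
    (∀ e ∈ P, Avoids (hub n m) e) ∧ LinForest (pairs P)) (Nat.zero_le b) ?_ ?_
  · refine ⟨fun e he => by simp [process] at he, List.finRange n, ⟨List.nodup_finRange n, by simp⟩,
      fun a b hab => ?_⟩
    obtain ⟨e, he, -⟩ := hab
    simp [process] at he
  · intro s h0 hs P e hP he
    obtain ⟨h1, h2⟩ := (hS s h0 hs P e).1 he
    refine ⟨fun e' he' => ?_, h2⟩
    rcases Finset.mem_insert.1 he' with rfl | he'
    · exact h1
    · exact hP.1 e' he'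

/-- The links form an almost spanning path system. -/
theorem uprob_few_links {n m b : ℕ} {S : Strategy n} (hS : Links m S 0 b) (hn : 0 < n)
    (hm : 3 * m ≤ n) (hb : b ≤ Fintype.card (CEdge n)) (hbm : 2 * b ≤ m ^ 2) :
    uprob (fun ω : EdgeOrdering n => (process S ω b).card < n - 8 * m) ≤
      (1 - (m ^ 2 : ℕ) / (n : ℝ) ^ 3) ^ b * n := by
  have hg : ((m ^ 2 : ℕ) : ℝ) ≤ (n : ℝ) ^ 3 := by
    have h1 : m ^ 2 ≤ n ^ 3 :=
      (Nat.pow_le_pow_left (by omega) 2).trans (Nat.pow_le_pow_right hn (by norm_num))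
    exact_mod_cast h1
  have h := uprob_pos_le S (fun _ P => n - 8 * m - P.card) (Nat.zero_le b) hb hbm hg hn
    (fun ω s _ _ => by omega)
    (fun ω s _ _ e => by
      have := Finset.card_le_card (subset_nextGraph S s (process S ω s) e)
      omega)
    (fun ω s _ hsb hpos => by
      have hinv := (show Links m S 0 s from fun s' h1 h2 => hS s' h1 (by omega)).invariant ω
      obtain ⟨D, hD, hDe⟩ := exists_extensions (card_hub_le n m) hinv.2 (by omega)
      refine ⟨D, hD, fun e he => ?_⟩
      obtain ⟨h1, h2, h3⟩ := hDe e he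
      unfold nextGraph
      rw [if_pos ((hS s (Nat.zero_le s) hsb _ e).2 ⟨h2, h3⟩), Finset.card_insert_of_notMem h1]
      omega)
  rw [Nat.sub_zero] at h
  exact (uprob_mono fun ω hω => by omega).trans h

end Links

section Boosters

/-- The vertices that are in the hub or adjacent to it. -/
noncomputable def active {n : ℕ} (m : ℕ) (P : Finset (CEdge n)) : Finset (Fin n) :=
  Finset.univ.filter fun v => v ∈ hub n m ∨ ∃ x ∈ hub n m, s(v, x) ∈ pairs P

/-- The edges of `P` with an inactive endpoint. -/
def fixedEdges {n : ℕ} (m : ℕ) (P : Finset (CEdge n)) : Set (Sym2 (Fin n)) :=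
  {z | z ∈ pairs P ∧ ∃ v ∈ z, v ∉ active m P}

/-- The number of edges missing from a Hamilton cycle that uses all fixed edges. -/
noncomputable def deficit {n : ℕ} (m : ℕ) (P : Finset (CEdge n)) : ℕ :=
  completion (toGraph n P) (fixedEdges m P)

/-- `e` joins two active vertices and brings the graph closer to Hamiltonicity. -/
def IsBooster {n : ℕ} (m : ℕ) (P : Finset (CEdge n)) (e : CEdge n) : Prop :=
  (∀ v ∈ e.val, v ∈ active m P) ∧ deficit m (insert e P) < deficit m P

/-- Builder purchases exactly the boosters between the times `a` and `b`. -/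
def Boosts {n : ℕ} (m : ℕ) (S : Strategy n) (a b : ℕ) : Prop :=
  ∀ s, a ≤ s → s < b → ∀ P e, S s P e = true ↔ IsBooster m P e

/-- Small sets of active vertices expand into the hub, inactive vertices have two fixed edges, and
the fixed edges form a linear forest. -/
structure Robust {n : ℕ} (m r : ℕ) (P : Finset (CEdge n)) : Prop where
  two_fixed : ∀ v, v ∉ active m P →
    ∃ p q, p ≠ q ∧ s(p, v) ∈ fixedEdges m P ∧ s(q, v) ∈ fixedEdges m P
  expands : ∀ X ⊆ active m P, X.Nonempty → X.card ≤ r →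
    3 * X.card < ((hub n m).filter fun x => ∃ v ∈ X, (toGraph n P).Adj v x).card
  linForest : LinForest (fixedEdges m P)

theorem mem_active {n m : ℕ} {P : Finset (CEdge n)} {v : Fin n} :
    v ∈ active m P ↔ v ∈ hub n m ∨ ∃ x ∈ hub n m, s(v, x) ∈ pairs P := by
  simp [active]

theorem active_insert {n m : ℕ} {P : Finset (CEdge n)} {e : CEdge n}
    (h : ∀ v ∈ e.val, v ∈ active m P) : active m (insert e P) = active m P := by
  ext v
  constructor
  · intro hv
    rcases mem_active.1 hv with h1 | ⟨x, hx, h1⟩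
    · exact mem_active.2 (Or.inl h1)
    · rcases pairs_insert.1 h1 with h2 | h2
      · exact h v (by rw [← h2]; simp)
      · exact mem_active.2 (Or.inr ⟨x, hx, h2⟩)
  · intro hv
    rcases mem_active.1 hv with h1 | ⟨x, hx, h1⟩
    · exact mem_active.2 (Or.inl h1)
    · exact mem_active.2 (Or.inr ⟨x, hx, pairs_insert.2 (Or.inr h1)⟩)

theorem fixedEdges_insert {n m : ℕ} {P : Finset (CEdge n)} {e : CEdge n}
    (h : ∀ v ∈ e.val, v ∈ active m P) : fixedEdges m (insert e P) = fixedEdges m P := by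
  ext z
  simp only [fixedEdges, Set.mem_ofPred_eq, active_insert h, pairs_insert]
  constructor
  · rintro ⟨rfl | h1, v, hv, h2⟩
    · exact absurd (h v hv) h2
    · exact ⟨h1, v, hv, h2⟩
  · rintro ⟨h1, h2⟩
    exact ⟨Or.inr h1, h2⟩

theorem fixedEdges_avoid {n m : ℕ} {P : Finset (CEdge n)} {z : Sym2 (Fin n)}
    (h : z ∈ fixedEdges m P) : ∀ v ∈ z, v ∉ hub n m := by
  obtain ⟨h1, v, hv, h2⟩ := h
  obtain ⟨w, rfl⟩ := hv
  intro u hu hub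
  rcases Sym2.mem_iff.1 hu with rfl | rfl
  · exact h2 (mem_active.2 (Or.inl hub))
  · exact h2 (mem_active.2 (Or.inr ⟨u, hub, h1⟩))

theorem Robust.insert {n m r : ℕ} {P : Finset (CEdge n)} {e : CEdge n} (hP : Robust m r P)
    (h : ∀ v ∈ e.val, v ∈ active m P) : Robust m r (insert e P) where
  two_fixed := by
    rw [active_insert h, fixedEdges_insert h]
    exact hP.two_fixed
  expands := by
    rw [active_insert h]
    intro X hX hne hr
    refine (hP.expands X hX hne hr).trans_le (Finset.card_le_card fun x hx => ?_)
    obtain ⟨h1, v, hv, h2⟩ := Finset.mem_filter.1 hx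
    exact Finset.mem_filter.2 ⟨h1, v, hv, toGraph_mono (Finset.subset_insert e P) h2⟩
  linForest := by
    rw [fixedEdges_insert h]
    exact hP.linForest

theorem Robust.deficit_le {n m r : ℕ} {P : Finset (CEdge n)} (hP : Robust m r P) (hn : 0 < n) :
    deficit m P ≤ n := by
  obtain ⟨l, hl, hc⟩ := hP.linForest
  have hlen := hl.length_eq
  refine (completion_le hl hc).trans ?_
  have h1 := breaks_add_card_le (G := toGraph n P) (l := l) (P := ∅)
    (fun a b ⟨e, he, _⟩ => by simp at he) (fun a b ⟨e, he, _⟩ => by simp at he)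
    (by rintro rfl; simp at hlen; omega)
  unfold cyclicBreaks
  rw [hlen] at h1
  split_ifs <;> omega

theorem Robust.exists_boosters {n m r : ℕ} {P : Finset (CEdge n)} (hP : Robust m r P)
    (hn : 2 ≤ n) (hpos : 0 < deficit m P) :
    r ^ 2 ≤ 2 * (Finset.univ.filter fun e => IsBooster m P e).card := by
  have hFG : ∀ a b, s(a, b) ∈ fixedEdges m P → (toGraph n P).Adj a b :=
    fun a b h => toGraph_adj.2 h.1
  obtain ⟨T, hT, hTR⟩ := _root_.exists_boosters hFG
    (fun a b h => fixedEdges_avoid h a (by simp)) hP.two_fixed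
    (fun X h1 h2 h3 => by convert hP.expands X h1 h2 h3) hP.linForest hpos
    (by rw [Fintype.card_fin]; exact hn)
  set D := Finset.univ.filter fun e => IsBooster m P e with hD
  have hdeg : ∀ u ∈ T, r ≤ vdeg D u := by
    intro u hu
    obtain ⟨R, hR, hRw⟩ := hTR u hu
    refine hR.le.trans ?_
    have hsub : R ⊆ Finset.univ.filter fun w => ∃ h : u ≠ w, edge u w h ∈ D := by
      intro w hw
      obtain ⟨hne, huA, hwA, hdec⟩ := hRw w hw
      refine Finset.mem_filter.2 ⟨Finset.mem_univ _, hne, Finset.mem_filter.2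
        ⟨Finset.mem_univ _, ?_, ?_⟩⟩
      · intro v hv
        rcases Sym2.mem_iff.1 hv with rfl | rfl
        · exact huA
        · exact hwA
      · unfold deficit
        rw [fixedEdges_insert]
        · exact hdec _ (toGraph_mono (Finset.subset_insert _ _))
            (toGraph_adj.2 (pairs_insert.2 (Or.inl rfl)))
        · intro v hv
          rcases Sym2.mem_iff.1 hv with rfl | rfl
          · exact huA
          · exact hwA
    have hR' : ∀ w ∈ R, ∃ h : u ≠ w, edge u w h ∈ D := fun w hw =>
      (Finset.mem_filter.1 (hsub hw)).2
    unfold vdeg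
    refine Finset.card_le_card_of_forall_subsingleton (fun w e => e.val = s(u, w)) ?_ ?_
    · intro w hw
      obtain ⟨h, hmem⟩ := hR' w hw
      exact ⟨edge u w h, Finset.mem_filter.2 ⟨hmem, by simp [edge]⟩, rfl⟩
    · rintro e - w ⟨-, h1⟩ w' ⟨-, h2⟩
      exact Sym2.congr_right.1 (h1.symm.trans h2)
  rw [← sum_vdeg, sq]
  calc r * r ≤ T.card * r := Nat.mul_le_mul_right r hT.le
    _ ≤ ∑ u ∈ T, vdeg D u := by
      rw [← smul_eq_mul]
      exact Finset.card_nsmul_le_sum _ _ _ hdeg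
    _ ≤ ∑ u, vdeg D u := Finset.sum_le_sum_of_subset (Finset.subset_univ T)

theorem Boosts.robust {n m r a b : ℕ} {S : Strategy n} (hS : Boosts m S a b)
    {ω : EdgeOrdering n} (hab : a ≤ b) (h : Robust m r (process S ω a)) :
    Robust m r (process S ω b) :=
  process_invariant (p := Robust m r) hab h fun s h1 h2 P e hP he =>
    hP.insert ((hS s h1 h2 P e).1 he).1

theorem Boosts.card_add_deficit_le {n m a b : ℕ} {S : Strategy n} (hS : Boosts m S a b)
    {ω : EdgeOrdering n} (hab : a ≤ b) :
    (process S ω b).card + deficit m (process S ω b) ≤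
      (process S ω a).card + deficit m (process S ω a) := by
  refine process_invariant (p := fun P => P.card + deficit m P ≤
    (process S ω a).card + deficit m (process S ω a)) hab le_rfl fun s h1 h2 P e hP he => ?_
  have h3 := ((hS s h1 h2 P e).1 he).2
  have h4 := Finset.card_insert_le e P
  omega

/-- The boosters complete a Hamilton cycle. -/
theorem uprob_deficit_pos {n m r g a b : ℕ} {S : Strategy n} (hS : Boosts m S a b) (hn : 2 ≤ n)
    (hab : a ≤ b) (hb : b ≤ Fintype.card (CEdge n)) (hgr : 2 * g ≤ r ^ 2) (hbg : 2 * b ≤ g)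
    (hg : (g : ℝ) ≤ (n : ℝ) ^ 3) :
    uprob (fun ω : EdgeOrdering n => Robust m r (process S ω a) ∧ 0 < deficit m (process S ω b)) ≤
      (1 - g / (n : ℝ) ^ 3) ^ (b - a) * n := by
  have hS' : ∀ s, s ≤ b → Boosts m S a s := fun s hs s' h1 h2 => hS s' h1 (by omega)
  have h := uprob_pos_le S (fun A P => if Robust m r A then deficit m P else 0) hab hb hbg hg
    (by omega)
    (fun ω s has hsb => by
      split_ifs with hA
      · exact ((hS' s hsb).robust has hA).deficit_le (by omega)
      · omega)
    (fun ω s has hsb e => by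
      split_ifs with hA
      · unfold nextGraph
        split_ifs with he
        · exact ((hS s has hsb _ e).1 he).2.le
        · exact le_rfl
      · exact le_rfl)
    (fun ω s has hsb hpos => by
      split_ifs at hpos with hA
      · have hR := (hS' s hsb.le).robust has hA
        refine ⟨Finset.univ.filter fun e => IsBooster m (process S ω s) e, ?_, fun e he => ?_⟩
        · have := hR.exists_boosters hn hpos
          omega
        · rw [if_pos hA, if_pos hA]
          have he' := (Finset.mem_filter.1 he).2
          unfold nextGraph
          rw [if_pos ((hS s has hsb _ e).2 he')]
          exact he'.2
      · exact absurd hpos (lt_irrefl 0))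
  refine (uprob_mono fun ω hω => ?_).trans h
  rw [if_pos hω.1]
  exact hω.2

end Boosters

section Assembly

theorem odeg_eq_zero_of_avoids {n m : ℕ} {P : Finset (CEdge n)}
    (h : ∀ e ∈ P, Avoids (hub n m) e) (v : Fin n) : odeg m P v = 0 := by
  unfold odeg
  rw [Finset.card_eq_zero, Finset.filter_eq_empty_iff]
  rintro x - ⟨h1, e, he, h2⟩
  exact h e he x (by rw [h2]; simp) h1.mem_hub

theorem Connects.invariant {n m a b : ℕ} {S : Strategy n} (hS : Connects m S a b) (hab : a ≤ b)
    {ω : EdgeOrdering n} (ha : ∀ e ∈ process S ω a, Avoids (hub n m) e) :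
    base m (process S ω b) = process S ω a ∧
    deficient m (process S ω b) = deficient m (process S ω a) ∧
    (∀ e ∈ process S ω b, Avoids (hub n m) e ∨
      ∃ v x, e.val = s(v, x) ∧ Own m v x ∧ v ∈ deficient m (process S ω a)) ∧
    (∀ v, odeg m (process S ω b) v ≤ 5) ∧
    (process S ω b).card ≤ (process S ω a).card +
      ∑ v ∈ deficient m (process S ω a), odeg m (process S ω b) v := by
  have hzero : ∀ v, odeg m (process S ω a) v = 0 := odeg_eq_zero_of_avoids ha
  set A := process S ω a with hA
  refine process_invariant (p := fun P => base m P = A ∧ deficient m P = deficient m A ∧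
    (∀ e ∈ P, Avoids (hub n m) e ∨ ∃ v x, e.val = s(v, x) ∧ Own m v x ∧ v ∈ deficient m A) ∧
    (∀ v, odeg m P v ≤ 5) ∧ P.card ≤ A.card + ∑ v ∈ deficient m A, odeg m P v) hab ?_ ?_
  · refine ⟨?_, rfl, fun e he => Or.inl (ha e he), fun v => ?_, Nat.le_add_right _ _⟩
    · exact Finset.filter_true_of_mem ha
    · rw [← hA, hzero v]
      omega
  · rintro s h1 h2 P e ⟨p1, p2, p3, p4, p5⟩ he
    have hcon := (hS s h1 h2 P e).1 he
    have hna := hcon.not_avoids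
    obtain ⟨v, x, hvx, hown, hv, h5⟩ := hcon
    rw [p2] at hv
    refine ⟨by rw [base_insert hna, p1], ?_, fun e' he' => ?_, fun u => ?_, ?_⟩
    · unfold deficient at p2 ⊢
      rw [base_insert hna, p2]
    · rcases Finset.mem_insert.1 he' with rfl | he'
      · exact Or.inr ⟨v, x, hvx, hown, hv⟩
      · exact p3 e' he'
    · by_cases heP : e ∈ P
      · rw [Finset.insert_eq_of_mem heP]
        exact p4 u
      · by_cases hu : u = v
        · subst hu
          rw [odeg_insert_own hown hvx heP]
          omega
        · rw [odeg_insert_of_not_own]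
          · exact p4 u
          · intro y hy hey
            exact hu (hy.unique hown (hey.symm.trans hvx)).1
    · by_cases heP : e ∈ P
      · rw [Finset.insert_eq_of_mem heP]
        exact p5
      · rw [Finset.card_insert_of_notMem heP]
        have : ∑ u ∈ deficient m A, odeg m P u < ∑ u ∈ deficient m A, odeg m (insert e P) u := by
          refine Finset.sum_lt_sum (fun u _ => odeg_mono (Finset.subset_insert e P) u) ⟨v, hv, ?_⟩
          rw [odeg_insert_own hown hvx heP]
          omega
        omega

/-- An almost spanning path system whose deficient vertices are well connected to the hub is
robust. -/
theorem robust_of_connected {n m r a b : ℕ} {S : Strategy n} (hL : Links m S 0 a)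
    (hC : Connects m S a b) (hab : a ≤ b) (hr : 3 * r ≤ n) {ω : EdgeOrdering n}
    (hsat : ∀ v ∈ deficient m (process S ω b), 5 ≤ odeg m (process S ω b) v)
    (hexp : ∀ X ⊆ deficient m (process S ω b), 0 < X.card → X.card ≤ r → ∀ U : Finset (Fin n),
      U.card = 3 * X.card → ∃ v ∈ X, ∃ x, Own m v x ∧ s(v, x) ∈ pairs (process S ω b) ∧ x ∉ U) :
    Robust m r (process S ω b) := by
  obtain ⟨hav, hlin⟩ := hL.invariant ω
  obtain ⟨h1, h2, h3, -, -⟩ := hC.invariant hab hav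
  set P := process S ω b with hP
  have hact : active m P = deficient m P := by
    ext v
    constructor
    · intro hv
      rcases mem_active.1 hv with hv | ⟨x, hx, e, he, hvx⟩
      · exact Finset.mem_filter.2 ⟨Finset.mem_univ _, Or.inl hv⟩
      · rcases h3 e he with h | ⟨v', x', hvx', hown, hdef⟩
        · exact absurd hx (h x (by rw [hvx]; simp))
        · rcases Sym2.eq_iff.1 (hvx.symm.trans hvx') with ⟨rfl, rfl⟩ | ⟨rfl, rfl⟩
          · rw [h2]
            exact hdef
          · exact Finset.mem_filter.2 ⟨Finset.mem_univ _, Or.inl hown.mem_hub⟩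
    · intro hv
      have h5 := hsat v hv
      have hpos : 0 < odeg m P v := by omega
      obtain ⟨x, hx⟩ := Finset.card_pos.1 hpos
      obtain ⟨-, hx1, hx2⟩ := Finset.mem_filter.1 hx
      exact mem_active.2 (Or.inr ⟨x, hx1.mem_hub, hx2⟩)
  refine ⟨fun v hv => ?_, fun X hX hne hXr => ?_, ?_⟩
  · have hv' : v ∉ deficient m P := hact ▸ hv
    have hdeg : 2 ≤ vdeg (base m P) v := by
      by_contra hcon
      exact hv' (Finset.mem_filter.2 ⟨Finset.mem_univ _, Or.inr (by omega)⟩)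
    obtain ⟨e, he, e', he', hne⟩ := Finset.one_lt_card.1 hdeg
    obtain ⟨heb, hev⟩ := Finset.mem_filter.1 he
    obtain ⟨heb', hev'⟩ := Finset.mem_filter.1 he'
    obtain ⟨p, hp⟩ := hev
    obtain ⟨q, hq⟩ := hev'
    refine ⟨p, q, ?_, ⟨⟨e, (Finset.mem_filter.1 heb).1, ?_⟩, v, by simp, hv⟩,
      ⟨⟨e', (Finset.mem_filter.1 heb').1, ?_⟩, v, by simp, hv⟩⟩
    · rintro rfl
      exact hne (Subtype.ext (hp.trans hq.symm))
    · rw [hp, Sym2.eq_swap]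
    · rw [hq, Sym2.eq_swap]
  · by_contra hcon
    rw [not_lt] at hcon
    obtain ⟨U, hU, hUc⟩ := Finset.exists_superset_card_eq hcon
      (by rw [Fintype.card_fin]; omega)
    obtain ⟨v, hv, x, hown, hvx, hxU⟩ := hexp X (hact ▸ hX) hne.card_pos hXr U hUc
    exact hxU (hU (Finset.mem_filter.2 ⟨hown.mem_hub, v, hv, toGraph_adj.2 hvx⟩))
  · refine hlin.mono ?_
    rintro z hz
    have hz' := fixedEdges_avoid hz
    obtain ⟨⟨e, he, rfl⟩, -⟩ := hz
    rw [← h1]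
    exact ⟨e, Finset.mem_filter.2 ⟨he, hz'⟩, rfl⟩

/-- A robust graph obtained from `k` fewer than `n` links has few edges and few missing ones. -/
theorem card_add_deficit_le {n m k a b : ℕ} {S : Strategy n} (hL : Links m S 0 a)
    (hC : Connects m S a b) (hab : a ≤ b) (hn : 0 < n) {ω : EdgeOrdering n}
    (hk : n ≤ (process S ω a).card + k) :
    (process S ω b).card + deficit m (process S ω b) ≤ n + 5 * (3 * m + 2 * k) := by
  obtain ⟨hav, l, hl, hc⟩ := hL.invariant ω
  obtain ⟨h1, h2, h3, h4, h5⟩ := hC.invariant hab hav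
  set A := process S ω a with hA
  set P := process S ω b with hP
  have hlen := hl.length_eq
  have hsub : fixedEdges m P ⊆ pairs A := by
    rintro z hz
    have hz' := fixedEdges_avoid hz
    obtain ⟨⟨e, he, rfl⟩, -⟩ := hz
    rw [← h1]
    exact ⟨e, Finset.mem_filter.2 ⟨he, hz'⟩, rfl⟩
  have hdef : deficit m P ≤ n - A.card := by
    refine (completion_le hl fun x y hxy => hc x y (hsub hxy)).trans ?_
    have h6 := breaks_add_card_le (G := toGraph n P) (P := A)
      (fun x y h => toGraph_adj.2 (pairs_mono (process_mono S ω hab) h)) hc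
      (by rintro rfl; simp at hlen; omega)
    rw [hlen] at h6
    unfold cyclicBreaks
    split_ifs <;> omega
  have hAn : A.card ≤ n := by
    have h6 := breaks_add_card_le (G := toGraph n A) (P := A) (fun x y h => toGraph_adj.2 h) hc
      (by rintro rfl; simp at hlen; omega)
    omega
  have hcard : (deficient m A).card ≤ 3 * m + 2 * k := by
    have hbase : base m A = A := Finset.filter_true_of_mem hav
    unfold deficient
    rw [hbase, Finset.filter_or]
    refine (Finset.card_union_le _ _).trans (add_le_add ?_ (card_low_degree_le ⟨l, hl, hc⟩ hk))
    rw [Finset.filter_univ_mem]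
    exact card_hub_le n m
  have hsum : ∑ v ∈ deficient m A, odeg m P v ≤ (deficient m A).card * 5 := by
    rw [← smul_eq_mul]
    exact Finset.sum_le_card_nsmul _ _ _ fun v _ => h4 v
  omega

theorem process_eq_of_rejects {n a b : ℕ} {S : Strategy n} (hab : a ≤ b)
    (hS : ∀ s, a ≤ s → ∀ P e, S s P e = false) (ω : EdgeOrdering n) :
    process S ω b = process S ω a :=
  process_invariant (p := fun P => P = process S ω a) hab rfl
    fun s h1 _ P e _ he => by simp [hS s h1 P e] at he

theorem isHamiltonian_build {n m r t₁ t₂ t₃ t b : ℕ} {S : Strategy n} (hL : Links m S 0 t₁)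
    (hC : Connects m S t₁ t₂) (hB : Boosts m S t₂ t₃) (h12 : t₁ ≤ t₂) (h23 : t₂ ≤ t₃)
    (h3t : t₃ ≤ t) (hS : ∀ s, t₃ ≤ s → ∀ P e, S s P e = false) (hn : 3 ≤ n) (hr : 3 * r ≤ n)
    (hb : n + 95 * m ≤ b) {ω : EdgeOrdering n}
    (hlinks : ¬ (process S ω t₁).card < n - 8 * m)
    (hseen : ∀ v, ¬ m < 2 * odeg m (seen ω t₂) v)
    (hsat : ∀ v, ¬ (v ∈ deficient m (process S ω t₂) ∧ odeg m (process S ω t₂) v < 5 ∧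
      2 * odeg m (seen ω t₂) v ≤ m))
    (hconf : ∀ X U : Finset (Fin n), 0 < X.card → X.card ≤ r → U.card = 3 * X.card →
      ¬ (X ⊆ deficient m (process S ω t₂) ∧ (∀ v ∈ X, 2 * odeg m (seen ω t₂) v ≤ m) ∧
        (∀ v ∈ X, 5 ≤ odeg m (process S ω t₂) v) ∧
        ∀ v ∈ X, ∀ x, Own m v x → s(v, x) ∈ pairs (process S ω t₂) → x ∈ U))
    (hdone : ¬ (Robust m r (process S ω t₂) ∧ 0 < deficit m (process S ω t₃))) :
    (toGraph n (build n b S ω t)).IsHamiltonian := by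
  have hseen' : ∀ v, 2 * odeg m (seen ω t₂) v ≤ m := fun v => not_lt.1 (hseen v)
  have hsat' : ∀ v ∈ deficient m (process S ω t₂), 5 ≤ odeg m (process S ω t₂) v := by
    intro v hv
    by_contra hcon
    exact hsat v ⟨hv, by omega, hseen' v⟩
  have hrob : Robust m r (process S ω t₂) := by
    refine robust_of_connected hL hC h12 hr hsat' fun X hX h0 hXr U hU => ?_
    by_contra hcon
    push Not at hcon
    exact hconf X U h0 hXr hU ⟨hX, fun v _ => hseen' v, fun v hv => hsat' v (hX hv),
      fun v hv x => hcon v hv x⟩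
  have hzero : deficit m (process S ω t₃) = 0 := by
    by_contra hcon
    exact hdone ⟨hrob, Nat.pos_of_ne_zero hcon⟩
  have hcard := card_add_deficit_le hL hC h12 (by omega) (ω := ω) (k := 8 * m) (by omega)
  have hcard' := hB.card_add_deficit_le (ω := ω) h23
  have heq : build n b S ω t = process S ω t₃ := by
    rw [build_eq_process, process_eq_of_rejects h3t hS]
    rw [process_eq_of_rejects h3t hS]
    omega
  rw [heq]
  exact isHamiltonian_of_completion_eq_zero (by rw [Fintype.card_fin]; exact hn)
    (hB.robust h23 hrob).linForest hzero

end Assembly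

section Asymptotics

/-- Builder purchases links until time `t₁`, then connectors until time `t₂`, and finally boosters
until time `t₃`. -/
noncomputable def threePhases (n m t₁ t₂ t₃ : ℕ) : Strategy n := fun s P e =>
  if s < t₁ then decide (IsLink m P e)
  else if s < t₂ then decide (IsConnector m P e)
  else if s < t₃ then decide (IsBooster m P e)
  else false

theorem threePhases_links (n m t₁ t₂ t₃ : ℕ) : Links m (threePhases n m t₁ t₂ t₃) 0 t₁ := by
  intro s _ hs P e
  simp [threePhases, hs]

theorem threePhases_connects (n m t₁ t₂ t₃ : ℕ) :
    Connects m (threePhases n m t₁ t₂ t₃) t₁ t₂ := by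
  intro s h1 hs P e
  simp [threePhases, hs, not_lt.2 h1]

theorem threePhases_boosts (n m : ℕ) {t₁ t₂ : ℕ} (h12 : t₁ ≤ t₂) (t₃ : ℕ) :
    Boosts m (threePhases n m t₁ t₂ t₃) t₂ t₃ := by
  intro s h1 hs P e
  simp [threePhases, hs, not_lt.2 h1, not_lt.2 (h12.trans h1)]

theorem threePhases_rejects (n m : ℕ) {t₁ t₂ t₃ : ℕ} (h12 : t₁ ≤ t₂) (h23 : t₂ ≤ t₃) (s : ℕ)
    (hs : t₃ ≤ s) (P : Finset (CEdge n)) (e : CEdge n) :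
    threePhases n m t₁ t₂ t₃ s P e = false := by
  simp [threePhases, not_lt.2 hs, not_lt.2 (h23.trans hs), not_lt.2 (h12.trans (h23.trans hs))]

/-- The failure probability of the strategy. -/
theorem one_le_uprob_isHamiltonian {n m r g t₁ t₂ t₃ t b : ℕ} (hn : 3 ≤ n) (h12 : t₁ ≤ t₂)
    (h23 : t₂ ≤ t₃) (h3t : t₃ ≤ t) (hb : n + 95 * m ≤ b) (hm : 3 * m ≤ n) (hr : 6 * r ≤ m)
    (ht : t₃ ≤ Fintype.card (CEdge n)) (hN : (n : ℝ) ^ 2 / 4 ≤ Fintype.card (CEdge n) - t₂)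
    (htm : 2 * t₁ ≤ m ^ 2) (hgr : 2 * g ≤ r ^ 2) (htg : 2 * t₃ ≤ g) :
    1 ≤ uprob (fun ω : EdgeOrdering n =>
        (toGraph n (build n b (threePhases n m t₁ t₂ t₃) ω t)).IsHamiltonian) +
      ((1 - (m ^ 2 : ℕ) / (n : ℝ) ^ 3) ^ t₁ * n +
      (n * ((1 + 4 / (n : ℝ)) ^ t₂ / 2 ^ (m / 2)) +
      (n * ((1 - m / (2 * (n : ℝ) ^ 2)) ^ (t₂ - t₁) * 32) +
      (∑ k ∈ Finset.Icc 1 r, (n.choose k : ℝ) * (n.choose (3 * k) *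
        (1 / ((m : ℝ) / (6 * k)) ^ (5 * k))) +
      (1 - g / (n : ℝ) ^ 3) ^ (t₃ - t₂) * n)))) := by
  have hL := threePhases_links n m t₁ t₂ t₃
  have hC := threePhases_connects n m t₁ t₂ t₃
  have hB := threePhases_boosts n m h12 t₃
  have hS := threePhases_rejects n m h12 h23
  set S := threePhases n m t₁ t₂ t₃ with hSdef
  have hg : (g : ℝ) ≤ (n : ℝ) ^ 3 := by
    have h1 : g ≤ n ^ 3 := by
      have h2 : r ^ 2 ≤ n ^ 2 := Nat.pow_le_pow_left (by omega) 2
      have h3 : n ^ 2 ≤ n ^ 3 := Nat.pow_le_pow_right (by omega) (by norm_num)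
      omega
    exact_mod_cast h1
  have : Nonempty (EdgeOrdering n) := ⟨(Fintype.equivFin (CEdge n)).symm⟩
  have e1 := uprob_few_links hL (by omega) hm (by omega) htm
  have e2 : uprob (fun ω : EdgeOrdering n => ∃ v ∈ (Finset.univ : Finset (Fin n)),
      m < 2 * odeg m (seen ω t₂) v) ≤ n * ((1 + 4 / (n : ℝ)) ^ t₂ / 2 ^ (m / 2)) := by
    refine (uprob_exists_le _ _).trans ((Finset.sum_le_card_nsmul _ _ _ fun v _ =>
      uprob_owned_large S hm (by omega) v (by omega) hN).trans (le_of_eq ?_))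
    rw [Finset.card_univ, Fintype.card_fin, nsmul_eq_mul]
  have e3 : uprob (fun ω : EdgeOrdering n => ∃ v ∈ (Finset.univ : Finset (Fin n)),
      v ∈ deficient m (process S ω t₂) ∧ odeg m (process S ω t₂) v < 5 ∧
        2 * odeg m (seen ω t₂) v ≤ m) ≤
      n * ((1 - m / (2 * (n : ℝ) ^ 2)) ^ (t₂ - t₁) * 32) := by
    refine (uprob_exists_le _ _).trans ((Finset.sum_le_card_nsmul _ _ _ fun v _ =>
      uprob_unsaturated hC hm (by omega) v h12 (by omega)).trans (le_of_eq ?_))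
    rw [Finset.card_univ, Fintype.card_fin, nsmul_eq_mul]
  have e4 : uprob (fun ω : EdgeOrdering n => ∃ k ∈ Finset.Icc 1 r,
      ∃ X ∈ (Finset.univ : Finset (Fin n)).powersetCard k,
      ∃ U ∈ (Finset.univ : Finset (Fin n)).powersetCard (3 * k),
      X ⊆ deficient m (process S ω t₂) ∧ (∀ v ∈ X, 2 * odeg m (seen ω t₂) v ≤ m) ∧
        (∀ v ∈ X, 5 ≤ odeg m (process S ω t₂) v) ∧
        ∀ v ∈ X, ∀ x, Own m v x → s(v, x) ∈ pairs (process S ω t₂) → x ∈ U) ≤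
      ∑ k ∈ Finset.Icc 1 r, (n.choose k : ℝ) * (n.choose (3 * k) *
        (1 / ((m : ℝ) / (6 * k)) ^ (5 * k))) := by
    refine (uprob_exists_le _ _).trans (Finset.sum_le_sum fun k hk => ?_)
    rw [Finset.mem_Icc] at hk
    refine (uprob_exists_le _ _).trans ((Finset.sum_le_card_nsmul _ _
      (n.choose (3 * k) * (1 / ((m : ℝ) / (6 * k)) ^ (5 * k))) fun X hX => ?_).trans
      (le_of_eq ?_))
    · refine (uprob_exists_le _ _).trans ((Finset.sum_le_card_nsmul _ _
        (1 / ((m : ℝ) / (6 * k)) ^ (5 * k)) fun U hU => ?_).trans (le_of_eq ?_))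
      · exact uprob_confined hC hm h12 (by omega) (by omega) (by omega)
          (fun ω v => odeg_eq_zero_of_avoids (hL.invariant ω).1 v)
          (Finset.mem_powersetCard.1 hX).2 (Finset.mem_powersetCard.1 hU).2.le
      · rw [Finset.card_powersetCard, Finset.card_univ, Fintype.card_fin, nsmul_eq_mul]
    · rw [Finset.card_powersetCard, Finset.card_univ, Fintype.card_fin, nsmul_eq_mul]
  have e5 := uprob_deficit_pos hB (by omega) h23 ht hgr htg hg
  refine (one_le_uprob_add (Q := fun ω => _ ∨ _ ∨ _ ∨ _ ∨ _) fun ω => ?_).trans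
    (add_le_add_right ((uprob_or_le _ _).trans (add_le_add e1 ((uprob_or_le _ _).trans
      (add_le_add e2 ((uprob_or_le _ _).trans (add_le_add e3 ((uprob_or_le _ _).trans
      (add_le_add e4 e5)))))))) _)
  by_contra hcon
  simp only [not_or] at hcon
  obtain ⟨h0, h1, h2, h3, h4, h5⟩ := hcon
  refine h0 (isHamiltonian_build hL hC hB h12 h23 h3t hS hn (by omega) hb h1
    (fun v hv => h2 ⟨v, Finset.mem_univ v, hv⟩) (fun v hv => h3 ⟨v, Finset.mem_univ v, hv⟩)
    (fun X U hX0 hXr hU hXU => h4 ⟨X.card, Finset.mem_Icc.2 ⟨hX0, hXr⟩, X, ?_, U, ?_, hXU⟩) h5)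
  · exact Finset.mem_powersetCard.2 ⟨Finset.subset_univ X, rfl⟩
  · exact Finset.mem_powersetCard.2 ⟨Finset.subset_univ U, hU⟩

theorem choose_le_exp_mul_pow {n k : ℕ} (hk : 0 < k) :
    (n.choose k : ℝ) ≤ (Real.exp 1 * n / k) ^ k := by
  have hk0 : (0 : ℝ) < k := by exact_mod_cast hk
  have h1 : (n.choose k : ℝ) ≤ (n : ℝ) ^ k / k.factorial := Nat.choose_le_pow_div k n
  have h2 : (k : ℝ) ^ k / k.factorial ≤ Real.exp k :=
    Real.pow_div_factorial_le_exp _ hk0.le k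
  refine h1.trans ?_
  have h3 : Real.exp (k : ℝ) = Real.exp 1 ^ k := by rw [← Real.exp_nat_mul, mul_one]
  rw [h3, div_le_iff₀ (by positivity)] at h2
  rw [div_pow, mul_pow, div_le_div_iff₀ (by positivity) (by positivity)]
  calc (n : ℝ) ^ k * k ^ k ≤ n ^ k * (Real.exp 1 ^ k * k.factorial) := by gcongr
    _ = _ := by ring

theorem choose_mul_choose_mul_le {n m k : ℕ} {δ : ℝ} (hδ : 0 < δ) (hn : 0 < n) (hk : 0 < k)
    (hm : δ / 2 * n ≤ m) :
    (n.choose k : ℝ) * (n.choose (3 * k) * (1 / ((m : ℝ) / (6 * k)) ^ (5 * k))) ≤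
      (Real.exp 1 ^ 4 * (12 / δ) ^ 5 * k / n) ^ k := by
  have hk0 : (0 : ℝ) < k := by exact_mod_cast hk
  have hn0 : (0 : ℝ) < n := by exact_mod_cast hn
  have hm0 : (0 : ℝ) < m := lt_of_lt_of_le (by positivity) hm
  have h1 := choose_le_exp_mul_pow (n := n) hk
  have h2 : (n.choose (3 * k) : ℝ) ≤ ((Real.exp 1 * n / k) ^ 3) ^ k := by
    refine (choose_le_exp_mul_pow (n := n) (k := 3 * k) (by omega)).trans ?_
    rw [← pow_mul]
    gcongr
    linarith
  have h3 : 1 / ((m : ℝ) / (6 * k)) ^ (5 * k) ≤ ((12 * k / (δ * n)) ^ 5) ^ k := by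
    rw [← pow_mul, ← one_div_pow]
    refine pow_le_pow_left₀ (by positivity) ?_ _
    rw [one_div_div, div_le_div_iff₀ hm0 (by positivity)]
    nlinarith
  calc _ ≤ (Real.exp 1 * n / k) ^ k *
        (((Real.exp 1 * n / k) ^ 3) ^ k * ((12 * k / (δ * n)) ^ 5) ^ k) := by gcongr
    _ = _ := by
      rw [← mul_pow, ← mul_pow]
      congr 1
      field_simp

theorem sum_choose_mul_choose_le {n m r : ℕ} {δ K : ℝ} (hδ : 0 < δ) (hn : 0 < n)
    (hm : δ / 2 * n ≤ m) (hK : K = Real.exp 1 ^ 4 * (12 / δ) ^ 5) (hr : K * r ≤ n / 4) :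
    ∑ k ∈ Finset.Icc 1 r, (n.choose k : ℝ) * (n.choose (3 * k) *
      (1 / ((m : ℝ) / (6 * k)) ^ (5 * k))) ≤ 8 * K / n := by
  have hn0 : (0 : ℝ) < n := by exact_mod_cast hn
  have hK0 : 0 < K := by rw [hK]; positivity
  have hterm : ∀ k ∈ Finset.Icc 1 r, (n.choose k : ℝ) * (n.choose (3 * k) *
      (1 / ((m : ℝ) / (6 * k)) ^ (5 * k))) ≤ 4 * K / n * (1 / 2) ^ k := by
    intro k hk
    rw [Finset.mem_Icc] at hk
    refine (choose_mul_choose_mul_le hδ hn (by omega) hm).trans ?_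
    rw [← hK]
    obtain ⟨j, rfl⟩ : ∃ j, k = j + 1 := ⟨k - 1, by omega⟩
    have hj : K * ((j + 1 : ℕ) : ℝ) / n ≤ 1 / 4 := by
      rw [div_le_iff₀ hn0]
      have : ((j + 1 : ℕ) : ℝ) ≤ r := by exact_mod_cast hk.2
      nlinarith
    have h2 : ((j + 1 : ℕ) : ℝ) ≤ 2 ^ (j + 1) := by
      exact_mod_cast (Nat.lt_two_pow_self (n := j + 1)).le
    rw [pow_succ]
    calc (K * ((j + 1 : ℕ) : ℝ) / n) ^ j * (K * ((j + 1 : ℕ) : ℝ) / n)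
        ≤ (1 / 4) ^ j * (K * 2 ^ (j + 1) / n) := by gcongr
      _ = 4 * K / n * ((1 / 4) ^ (j + 1) * 2 ^ (j + 1)) := by ring
      _ = 4 * K / n * (1 / 2) ^ (j + 1) := by rw [← mul_pow]; norm_num
  calc _ ≤ ∑ k ∈ Finset.Icc 1 r, 4 * K / n * (1 / 2 : ℝ) ^ k := Finset.sum_le_sum hterm
    _ ≤ ∑ k ∈ Finset.range (r + 1), 4 * K / n * (1 / 2 : ℝ) ^ k := by
      refine Finset.sum_le_sum_of_subset_of_nonneg (fun k hk => ?_) fun k _ _ => by positivity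
      rw [Finset.mem_Icc] at hk
      rw [Finset.mem_range]
      omega
    _ ≤ 4 * K / n * 2 := by
      rw [← Finset.mul_sum]
      exact mul_le_mul_of_nonneg_left (sum_geometric_two_le _) (by positivity)
    _ = 8 * K / n := by ring

theorem one_sub_pow_mul_le {n T : ℕ} {x : ℝ} (hn : 0 < n) (hx : x ≤ 1)
    (h : 2 * Real.log n ≤ x * T) : (1 - x) ^ T * n ≤ 1 / n := by
  have hn0 : (0 : ℝ) < n := by exact_mod_cast hn
  have h1 : (1 - x) ^ T ≤ 1 / (n : ℝ) ^ 2 := by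
    calc (1 - x) ^ T ≤ Real.exp (-x) ^ T :=
          pow_le_pow_left₀ (by linarith) (Real.one_sub_le_exp_neg x) T
      _ = Real.exp (-(x * T)) := by rw [← Real.exp_nat_mul]; ring_nf
      _ ≤ Real.exp (-(2 * Real.log n)) := Real.exp_le_exp.2 (by linarith)
      _ = 1 / (n : ℝ) ^ 2 := by
        rw [Real.exp_neg, mul_comm, Real.exp_mul, Real.exp_log hn0, one_div]
        norm_num
  calc (1 - x) ^ T * n ≤ 1 / (n : ℝ) ^ 2 * n := by gcongr
    _ = 1 / n := by field_simp

theorem one_add_pow_div_le {n T m : ℕ} (hn : 0 < n)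
    (h : 4 * T / (n : ℝ) + 2 * Real.log n + 1 ≤ m / 4) :
    n * ((1 + 4 / (n : ℝ)) ^ T / 2 ^ (m / 2)) ≤ 1 / n := by
  have hn0 : (0 : ℝ) < n := by exact_mod_cast hn
  have h1 : (1 + 4 / (n : ℝ)) ^ T ≤ Real.exp (4 * T / n) := by
    calc (1 + 4 / (n : ℝ)) ^ T ≤ Real.exp (4 / n) ^ T := by
          refine pow_le_pow_left₀ (by positivity) ?_ T
          rw [add_comm]
          exact Real.add_one_le_exp _
      _ = _ := by rw [← Real.exp_nat_mul]; ring_nf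
  have h2 : Real.exp (m / 4 - 1) ≤ 2 ^ (m / 2) := by
    have hm : (m : ℝ) ≤ 2 * (m / 2 : ℕ) + 1 := by
      have : m ≤ 2 * (m / 2) + 1 := by omega
      exact_mod_cast this
    calc Real.exp (m / 4 - 1) ≤ Real.exp ((m / 2 : ℕ) * (1 / 2)) :=
          Real.exp_le_exp.2 (by linarith)
      _ = Real.exp (1 / 2) ^ (m / 2) := Real.exp_nat_mul _ _
      _ ≤ 2 ^ (m / 2) := by
        refine pow_le_pow_left₀ (Real.exp_pos _).le ?_ _
        rw [← Real.le_log_iff_exp_le (by norm_num)]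
        linarith [Real.log_two_gt_d9]
  have h3 : Real.exp (4 * T / n) * (n : ℝ) ^ 2 ≤ 2 ^ (m / 2) := by
    calc Real.exp (4 * T / n) * (n : ℝ) ^ 2 = Real.exp (4 * T / n + 2 * Real.log n) := by
          rw [Real.exp_add, mul_comm 2, Real.exp_mul, Real.exp_log hn0]
          norm_num
      _ ≤ Real.exp (m / 4 - 1) := Real.exp_le_exp.2 (by linarith)
      _ ≤ _ := h2
  rw [← mul_div_assoc, div_le_div_iff₀ (by positivity) hn0]
  calc n * (1 + 4 / (n : ℝ)) ^ T * n ≤ n * Real.exp (4 * T / n) * n := by gcongr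
    _ = Real.exp (4 * T / n) * (n : ℝ) ^ 2 := by ring
    _ ≤ 1 * 2 ^ (m / 2) := by linarith

theorem two_mul_log_le {n T : ℕ} {q A C : ℝ} (hn : 0 < n) (hC : 0 ≤ C) (hA : q * n ^ 2 ≤ A)
    (hA0 : 0 ≤ A) (hT : C * n * Real.log n ≤ T) (hqC : 2 ≤ q * C) :
    2 * Real.log n ≤ A / (n : ℝ) ^ 3 * T := by
  have hn0 : (0 : ℝ) < n := by exact_mod_cast hn
  have hL : 0 ≤ Real.log n := Real.log_natCast_nonneg n
  calc 2 * Real.log n ≤ q * C * Real.log n := by gcongr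
    _ = q * n ^ 2 / (n : ℝ) ^ 3 * (C * n * Real.log n) := by field_simp
    _ ≤ A / (n : ℝ) ^ 3 * (C * n * Real.log n) := by gcongr
    _ ≤ A / (n : ℝ) ^ 3 * T := by gcongr

theorem constants_le {δ K c C : ℝ} (hδ : 0 < δ) (hδ1 : δ ≤ 1 / 100)
    (hK : K = Real.exp 1 ^ 4 * (12 / δ) ^ 5) (hc : c = 1 / (4 * K)) (hC : C = 32 / c ^ 2) :
    0 < K ∧ 0 < c ∧ 48 * c ≤ δ ∧ K * c = 1 / 4 ∧ C * c ^ 2 = 32 ∧ 1 ≤ C ∧ 8 ≤ C * δ ^ 2 ∧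
      8 ≤ C * δ := by
  have hx1 : 1 ≤ 12 / δ := by
    rw [le_div_iff₀ hδ]
    linarith
  have hKδ : 12 / δ ≤ K := by
    rw [hK]
    have h1 : (1 : ℝ) ≤ Real.exp 1 ^ 4 := one_le_pow₀ (Real.one_le_exp (by norm_num))
    have h2 : 12 / δ ≤ (12 / δ) ^ 5 := le_self_pow₀ hx1 (by norm_num)
    nlinarith
  have hK0 : 0 < K := by linarith
  have hc0 : 0 < c := by rw [hc]; positivity
  have hcK : K * c = 1 / 4 := by rw [hc]; field_simp
  have hcδ : 48 * c ≤ δ := by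
    have h1 : 12 ≤ K * δ := (div_le_iff₀ hδ).1 hKδ
    have h2 : K * (48 * c) ≤ K * δ := by linarith
    exact le_of_mul_le_mul_left h2 hK0
  have hC0 : 0 < C := by rw [hC]; positivity
  have hCc : C * c ^ 2 = 32 := by rw [hC]; field_simp
  have h1 : c ^ 2 ≤ δ ^ 2 := pow_le_pow_left₀ hc0.le (by linarith) 2
  have h2 : C * c ^ 2 ≤ C * δ ^ 2 := by gcongr
  have h3 : C * δ ^ 2 ≤ C * δ := by
    gcongr
    nlinarith
  have h4 : C * δ ≤ C * 1 := by
    gcongr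
    linarith
  exact ⟨hK0, hc0, hcδ, hcK, hCc, by linarith, by linarith, by linarith⟩

theorem exists_parameters {n : ℕ} {δ c C : ℝ} (hc : 0 < c) (hδ : 48 * c ≤ δ)
    (hδ1 : δ ≤ 1 / 100) (hC : 1 ≤ C) (hcn : 4 ≤ c * n) (hL : 1 ≤ Real.log n)
    (hCL : C * Real.log n + 1 ≤ c ^ 2 / 96 * n) :
    ∃ T m r g : ℕ, (C * n * Real.log n ≤ T ∧ (T : ℝ) ≤ C * n * Real.log n + 1) ∧
      ((m : ℝ) ≤ δ * n ∧ δ / 2 * n ≤ m ∧ δ * n ≤ m + 1) ∧ (r : ℝ) ≤ c * n ∧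
      c ^ 2 / 16 * n ^ 2 ≤ g ∧ 2 * g ≤ r ^ 2 ∧ 3 * m ≤ n ∧ 6 * r ≤ m ∧
      2 * T ≤ m ^ 2 ∧ 2 * (3 * T) ≤ g ∧ 3 * T ≤ Fintype.card (CEdge n) ∧
      (n : ℝ) ^ 2 / 4 ≤ Fintype.card (CEdge n) - (2 * T : ℕ) := by
  have hn0 : (0 : ℝ) < n := pos_of_mul_pos_right (lt_of_lt_of_le (by norm_num) hcn) hc.le
  have hδ0 : 0 < δ := by linarith
  have hδn : 48 * (c * n) ≤ δ * n := by
    rw [← mul_assoc]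
    gcongr
  have hδn1 : δ * n ≤ 1 / 100 * n := by gcongr
  obtain ⟨T, hT, hT'⟩ : ∃ T : ℕ, C * n * Real.log n ≤ T ∧ (T : ℝ) ≤ C * n * Real.log n + 1 :=
    ⟨⌈C * n * Real.log n⌉₊, Nat.le_ceil _, (Nat.ceil_lt_add_one (by positivity)).le⟩
  obtain ⟨m, hm, hm'⟩ : ∃ m : ℕ, (m : ℝ) ≤ δ * n ∧ δ * n ≤ m + 1 :=
    ⟨⌊δ * n⌋₊, Nat.floor_le (by positivity), (Nat.lt_floor_add_one _).le⟩
  obtain ⟨r, hr, hr'⟩ : ∃ r : ℕ, (r : ℝ) ≤ c * n ∧ c * n ≤ r + 1 :=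
    ⟨⌊c * n⌋₊, Nat.floor_le (by positivity), (Nat.lt_floor_add_one _).le⟩
  obtain ⟨g, hg, hg'⟩ : ∃ g : ℕ, 2 * g ≤ r ^ 2 ∧ r ^ 2 ≤ 2 * g + 1 :=
    ⟨r ^ 2 / 2, by omega, by omega⟩
  have hg2 : (r : ℝ) ^ 2 ≤ 2 * g + 1 := by exact_mod_cast hg'
  have hTn : (T : ℝ) ≤ (c * n) ^ 2 / 96 := by
    have h1 : (C * Real.log n + 1) * n ≤ c ^ 2 / 96 * n * n := by gcongr
    have h2 : c ^ 2 / 96 * n * n = (c * n) ^ 2 / 96 := by ring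
    have h3 : (C * Real.log n + 1) * n = C * n * Real.log n + n := by ring
    linarith
  have hgn : (c * n) ^ 2 / 16 ≤ g := by
    have h1 : (c * n / 2) ^ 2 ≤ (r : ℝ) ^ 2 :=
      pow_le_pow_left₀ (by positivity) (by linarith) 2
    have h2 : 4 ^ 2 ≤ (c * n) ^ 2 := pow_le_pow_left₀ (by norm_num) hcn 2
    have h3 : (c * n / 2) ^ 2 = (c * n) ^ 2 / 4 := by ring
    linarith
  have hcm : (c * n) ^ 2 ≤ (m : ℝ) ^ 2 := pow_le_pow_left₀ (by positivity) (by linarith) 2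
  have hcn' : (c * n) ^ 2 ≤ (1 / 100 * n : ℝ) ^ 2 :=
    pow_le_pow_left₀ (by positivity) (by linarith) 2
  have hn2 : 4 * (n : ℝ) ≤ n ^ 2 := by
    rw [sq]
    gcongr
    linarith
  have hcard : (Fintype.card (CEdge n) : ℝ) = n ^ 2 / 2 - n / 2 := by
    rw [card_cedge_eq]
    ring
  have hcT : 0 ≤ (c * n) ^ 2 := sq_nonneg _
  refine ⟨T, m, r, g, ⟨hT, hT'⟩, ⟨hm, by linarith, hm'⟩, hr, by linarith, hg,
    ?_, ?_, ?_, ?_, ?_, ?_⟩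
  · have : (3 * m : ℝ) ≤ n := by linarith
    exact_mod_cast this
  · have : (6 * r : ℝ) ≤ m := by linarith
    exact_mod_cast this
  · have : (2 * T : ℝ) ≤ (m : ℝ) ^ 2 := by linarith
    exact_mod_cast this
  · have : (2 * (3 * T) : ℝ) ≤ g := by linarith
    exact_mod_cast this
  · have : (3 * T : ℝ) ≤ Fintype.card (CEdge n) := by linarith
    exact_mod_cast this
  · push_cast
    linarith

theorem exists_strategy {n t b : ℕ} {δ K c C : ℝ} (hδ : 0 < δ) (hδ1 : δ ≤ 1 / 100)
    (hK : K = Real.exp 1 ^ 4 * (12 / δ) ^ 5) (hc : c = 1 / (4 * K)) (hC : C = 32 / c ^ 2)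
    (hcn : 4 ≤ c * n) (hL : 1 ≤ Real.log n) (hCL : C * Real.log n + 1 ≤ c ^ 2 / 96 * n)
    (hCm : (8 * C + 2) * Real.log n + 10 ≤ δ / 4 * n) (ht : 6 * C * n * Real.log n ≤ t)
    (hb : (1 + 95 * δ) * n ≤ b) :
    ∃ S : Strategy n, 1 - (35 + 8 * K) / n ≤
      uprob (fun ω : EdgeOrdering n => (toGraph n (build n b S ω t)).IsHamiltonian) := by
  obtain ⟨hK0, hc0, hcδ, hKc, hCc, hC1, hCδ2, hCδ⟩ := constants_le hδ hδ1 hK hc hC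
  obtain ⟨T, m, r, g, ⟨hT, hT'⟩, ⟨hm, hδn, hm'⟩, hr, hgn, hg, hmn, hrm, hTm, hTg, hT3, hT2⟩ :=
    exists_parameters hc0 hcδ hδ1 hC1 hcn hL hCL
  have hn0 : (0 : ℝ) < n := pos_of_mul_pos_right (lt_of_lt_of_le (by norm_num) hcn) hc0.le
  have hn : 0 < n := by exact_mod_cast hn0
  have hn3 : (4 : ℝ) ≤ n := by
    have : c * n ≤ 1 * n := by
      gcongr
      linarith
    linarith
  have hn1 : (n : ℝ) ^ 2 ≤ (n : ℝ) ^ 3 := pow_le_pow_right₀ (by linarith) (by norm_num)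
  have hmn' : (m : ℝ) ≤ n := by
    have : m ≤ n := by omega
    exact_mod_cast this
  have hmn2 : (m : ℝ) ^ 2 ≤ (n : ℝ) ^ 2 := pow_le_pow_left₀ (by positivity) hmn' 2
  have hgn3 : (g : ℝ) ≤ (n : ℝ) ^ 2 := by
    have h1 : r ^ 2 ≤ n ^ 2 := Nat.pow_le_pow_left (by omega) 2
    have h2 : g ≤ n ^ 2 := by omega
    exact_mod_cast h2
  refine ⟨threePhases n m T (2 * T) (3 * T), ?_⟩
  have hmain := one_le_uprob_isHamiltonian (n := n) (m := m) (r := r) (g := g) (t₁ := T)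
    (t₂ := 2 * T) (t₃ := 3 * T) (t := t) (b := b)
    (by
      have : (3 : ℝ) ≤ n := by linarith
      exact_mod_cast this) (by omega) (by omega)
    (by
      have h1 : 1 * 1 ≤ C * n * Real.log n :=
        mul_le_mul (by nlinarith) hL (by norm_num) (by positivity)
      have : (3 * T : ℝ) ≤ t := by linarith
      exact_mod_cast this)
    (by
      have : (n + 95 * m : ℝ) ≤ b := by linarith
      exact_mod_cast this)
    hmn hrm hT3 hT2 hTm hg hTg
  rw [show 2 * T - T = T by omega, show 3 * T - 2 * T = T by omega] at hmain
  have e1 : (1 - (m ^ 2 : ℕ) / (n : ℝ) ^ 3) ^ T * n ≤ 1 / n := by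
    refine one_sub_pow_mul_le hn ?_ (two_mul_log_le (q := δ ^ 2 / 4) hn (by linarith) ?_
      (Nat.cast_nonneg _) hT (by linarith))
    · rw [div_le_one (by positivity)]
      push_cast
      linarith
    · push_cast
      have : (δ / 2 * n) ^ 2 ≤ (m : ℝ) ^ 2 := pow_le_pow_left₀ (by positivity) hδn 2
      linarith
  have e2 : n * ((1 + 4 / (n : ℝ)) ^ (2 * T) / 2 ^ (m / 2)) ≤ 1 / n := by
    refine one_add_pow_div_le hn ?_
    have h1 : 4 * ((2 * T : ℕ) : ℝ) / n ≤ 8 * (C * Real.log n) + 8 := by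
      rw [div_le_iff₀ hn0]
      push_cast
      linarith
    linarith
  have e3 : n * ((1 - m / (2 * (n : ℝ) ^ 2)) ^ T * 32) ≤ 32 * (1 / n) := by
    have h1 : m / (2 * (n : ℝ) ^ 2) = (m * n / 2) / (n : ℝ) ^ 3 := by
      field_simp
    have h2 : (1 - m / (2 * (n : ℝ) ^ 2)) ^ T * n ≤ 1 / n := by
      rw [h1]
      refine one_sub_pow_mul_le hn ?_ (two_mul_log_le (q := δ / 4) hn (by linarith) ?_
        (by positivity) hT (by linarith))
      · rw [div_le_one (by positivity)]
        have : (m : ℝ) * n ≤ n * n := by gcongr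
        linarith
      · have : δ / 2 * n * n ≤ m * n := by gcongr
        linarith
    linarith
  have e4 := sum_choose_mul_choose_le hδ hn hδn hK (r := r) (by
    have : K * r ≤ K * (c * n) := by gcongr
    rw [← mul_assoc, hKc] at this
    linarith)
  have e5 : (1 - g / (n : ℝ) ^ 3) ^ T * n ≤ 1 / n :=
    one_sub_pow_mul_le hn ((div_le_one (by positivity)).2 (hgn3.trans hn1))
      (two_mul_log_le hn (by linarith) hgn (Nat.cast_nonneg _) hT (by linarith))
  have h35 : (35 + 8 * K) / n = 35 * (1 / (n : ℝ)) + 8 * K / n := by ring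
  linarith

theorem eventually_add_mul_log_le (A B : ℝ) {η : ℝ} (hη : 0 < η) :
    ∀ᶠ n : ℕ in atTop, A * Real.log n + B ≤ η * n := by
  have h1 : (fun x : ℝ => A * Real.log x + B) =o[atTop] (id : ℝ → ℝ) :=
    (Real.isLittleO_log_id_atTop.const_mul_left A).add
      (Asymptotics.isLittleO_const_id_atTop B)
  have h2 := tendsto_natCast_atTop_atTop (R := ℝ) |>.eventually (h1.def hη)
  filter_upwards [h2] with n hn
  refine (le_abs_self _).trans (hn.trans (le_of_eq ?_))
  rw [id, Real.norm_of_nonneg (Nat.cast_nonneg n)]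

end Asymptotics

/-- Hamiltonicity, optimal budget: for every `ε > 0` there is `C > 0` such that if
`t ≥ C n log n` and `b ≥ (1+ε) n`, Builder has a `(t,b)`-strategy whose purchased graph
is Hamiltonian with high probability. -/
theorem stmt3 (ε : ℝ) (hε : 0 < ε) :
    ∃ C : ℝ, 0 < C ∧
      ∀ t b : ℕ → ℕ,
        (∀ n : ℕ, C * n * Real.log n ≤ (t n : ℝ)) →
        (∀ n : ℕ, (1 + ε) * n ≤ (b n : ℝ)) →
        ∃ S : (n : ℕ) → Strategy n,
          Tendsto
            (fun n => uprob (fun ω : EdgeOrdering n =>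
              (toGraph n (build n (b n) (S n) ω (t n))).IsHamiltonian))
            atTop (nhds 1) := by
  obtain ⟨δ, hδ, hδ1, hδε⟩ : ∃ δ : ℝ, 0 < δ ∧ δ ≤ 1 / 100 ∧ 95 * δ ≤ ε :=
    ⟨min (1 / 100) (ε / 95), lt_min (by norm_num) (by positivity), min_le_left _ _, by
      linarith [min_le_right (1 / 100) (ε / 95)]⟩
  obtain ⟨K, hK⟩ : ∃ K, K = Real.exp 1 ^ 4 * (12 / δ) ^ 5 := ⟨_, rfl⟩
  obtain ⟨c, hc⟩ : ∃ c, c = 1 / (4 * K) := ⟨_, rfl⟩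
  obtain ⟨C, hC⟩ : ∃ C, C = 32 / c ^ 2 := ⟨_, rfl⟩
  obtain ⟨-, hc0, -, -, -, hC1, -, -⟩ := constants_le hδ hδ1 hK hc hC
  refine ⟨6 * C, by linarith, fun t b ht hb => ?_⟩
  have hex : ∀ᶠ n : ℕ in atTop, ∃ S : Strategy n, 1 - (35 + 8 * K) / n ≤
      uprob (fun ω : EdgeOrdering n => (toGraph n (build n (b n) S ω (t n))).IsHamiltonian) := by
    filter_upwards [eventually_add_mul_log_le 0 4 hc0,
      eventually_add_mul_log_le C 1 (by positivity : 0 < c ^ 2 / 96),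
      eventually_add_mul_log_le (8 * C + 2) 10 (by positivity : 0 < δ / 4),
      (Real.tendsto_log_atTop.comp (tendsto_natCast_atTop_atTop (R := ℝ))).eventually_ge_atTop 1]
      with n h1 h2 h3 h4
    refine exists_strategy hδ hδ1 hK hc hC (by linarith) h4 h2 h3 (ht n) (le_trans ?_ (hb n))
    gcongr
  have hne : ∀ n, Nonempty (Strategy n) := fun n => ⟨fun _ _ _ => false⟩
  choose! S hS using show ∀ n : ℕ, (∃ S : Strategy n, 1 - (35 + 8 * K) / n ≤
      uprob (fun ω : EdgeOrdering n => (toGraph n (build n (b n) S ω (t n))).IsHamiltonian)) →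
      ∃ S : Strategy n, 1 - (35 + 8 * K) / n ≤
      uprob (fun ω : EdgeOrdering n => (toGraph n (build n (b n) S ω (t n))).IsHamiltonian)
    from fun n h => h
  refine ⟨S, tendsto_of_tendsto_of_tendsto_of_le_of_le' (g := fun n : ℕ => 1 - (35 + 8 * K) / n)
    (h := fun _ => 1) ?_ tendsto_const_nhds (hex.mono hS) (.of_forall fun n => uprob_le_one _)⟩
  have h := (tendsto_const_div_atTop_nhds_zero_nat (35 + 8 * K)).const_sub 1
  rwa [sub_zero] at h
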